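/- Let k be a positive integer with k ≡ 0 (mod 4). Then the restriction map π_{1+i} : J_{k,1}(O_K) → J_{k,2}, (π_{1+i}φ)(τ,z) = φ(τ,(1+i)z,(1-i)z), is an isomorphism of ℂ-vector spaces. -/

import Mathlib

noncomputable section

open Complex

/-- `τ` lies in the upper half plane. -/
def UHP (τ : ℂ) : Prop := 0 < τ.im

/-- `eC w = exp(2 π i w)`. -/
def eC (w : ℂ) : ℂ := Complex.exp (2 * (Real.pi : ℂ) * Complex.I * w)

/-- Entries of a matrix in `SL(2, ℤ)`, as complex numbers. -/
def Ma (M : Matrix.SpecialLinearGroup (Fin 2) ℤ) : ℂ := ((M.1 0 0 : ℤ) : ℂ)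
def Mb (M : Matrix.SpecialLinearGroup (Fin 2) ℤ) : ℂ := ((M.1 0 1 : ℤ) : ℂ)
def Mc (M : Matrix.SpecialLinearGroup (Fin 2) ℤ) : ℂ := ((M.1 1 0 : ℤ) : ℂ)
def Md (M : Matrix.SpecialLinearGroup (Fin 2) ℤ) : ℂ := ((M.1 1 1 : ℤ) : ℂ)

/-- Hermitian Jacobi form of weight `k` and index `m` for the Hermitian Jacobi group over
`ℤ[i]`.  A form is a function `φ : ℂ → ℂ → ℂ → ℂ`, all conditions being imposed for `τ`
in the upper half plane.  Units `ε ∈ ℤ[i]ˣ = {1, -1, i, -i}`, and the elliptic variables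
`λ = p + q i`, `μ = u + v i` range over `ℤ[i]`.  The Fourier expansion is indexed by
`n ∈ ℕ` and `r = (a + b i)/2 ∈ O_K^♯ = (i/2)ℤ[i]`, supported on `N(r) ≤ n m`,
i.e. `a² + b² ≤ 4 n m`. -/
structure IsHJF (k m : ℕ) (φ : ℂ → ℂ → ℂ → ℂ) : Prop where
  holo : DifferentiableOn ℂ (fun p : ℂ × ℂ × ℂ => φ p.1 p.2.1 p.2.2) {p | UHP p.1}
  transf : ∀ ε : ℂ, ε ∈ ({1, -1, Complex.I, -Complex.I} : Set ℂ) →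
    ∀ M : Matrix.SpecialLinearGroup (Fin 2) ℤ, ∀ τ z₁ z₂ : ℂ, UHP τ →
      φ ((Ma M * τ + Mb M) / (Mc M * τ + Md M))
        (ε * z₁ / (Mc M * τ + Md M))
        ((starRingEnd ℂ) ε * z₂ / (Mc M * τ + Md M))
      = ε ^ k * (Mc M * τ + Md M) ^ k *
          eC ((m : ℂ) * Mc M * z₁ * z₂ / (Mc M * τ + Md M)) * φ τ z₁ z₂
  ellip : ∀ p q u v : ℤ, ∀ τ z₁ z₂ : ℂ, UHP τ →
      φ τ (z₁ + ((p : ℂ) + (q : ℂ) * Complex.I) * τ + ((u : ℂ) + (v : ℂ) * Complex.I))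
          (z₂ + ((p : ℂ) - (q : ℂ) * Complex.I) * τ + ((u : ℂ) - (v : ℂ) * Complex.I))
      = eC (-(m : ℂ) * (((p : ℂ) ^ 2 + (q : ℂ) ^ 2) * τ
          + ((p : ℂ) - (q : ℂ) * Complex.I) * z₁
          + ((p : ℂ) + (q : ℂ) * Complex.I) * z₂)) * φ τ z₁ z₂
  fourier : ∃ c : ℕ → ℤ → ℤ → ℂ,
      (∀ (n : ℕ) (a b : ℤ), 4 * (n : ℤ) * m < a ^ 2 + b ^ 2 → c n a b = 0) ∧
      ∀ τ z₁ z₂ : ℂ, UHP τ →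
        HasSum (fun p : ℕ × ℤ × ℤ => c p.1 p.2.1 p.2.2 *
          eC ((p.1 : ℂ) * τ + (((p.2.1 : ℂ) + (p.2.2 : ℂ) * Complex.I) / 2) * z₁
            + (((p.2.1 : ℂ) - (p.2.2 : ℂ) * Complex.I) / 2) * z₂)) (φ τ z₁ z₂)

/-- Classical Jacobi form of weight `k` and index `m` for `SL(2,ℤ) ⋉ ℤ²`. -/
structure IsJF (k m : ℕ) (φ : ℂ → ℂ → ℂ) : Prop where
  holo : DifferentiableOn ℂ (fun p : ℂ × ℂ => φ p.1 p.2) {p | UHP p.1}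
  transf : ∀ M : Matrix.SpecialLinearGroup (Fin 2) ℤ, ∀ τ z : ℂ, UHP τ →
      φ ((Ma M * τ + Mb M) / (Mc M * τ + Md M)) (z / (Mc M * τ + Md M))
      = (Mc M * τ + Md M) ^ k *
          eC ((m : ℂ) * Mc M * z ^ 2 / (Mc M * τ + Md M)) * φ τ z
  ellip : ∀ p q : ℤ, ∀ τ z : ℂ, UHP τ →
      φ τ (z + (p : ℂ) * τ + (q : ℂ))
      = eC (-(m : ℂ) * ((p : ℂ) ^ 2 * τ + 2 * (p : ℂ) * z)) * φ τ z
  fourier : ∃ c : ℕ → ℤ → ℂ,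
      (∀ (n : ℕ) (r : ℤ), 4 * (n : ℤ) * m < r ^ 2 → c n r = 0) ∧
      ∀ τ z : ℂ, UHP τ →
        HasSum (fun p : ℕ × ℤ => c p.1 p.2 * eC ((p.1 : ℂ) * τ + (p.2 : ℂ) * z)) (φ τ z)

/-- Modular form of weight `k` for `SL(2,ℤ)`. -/
structure IsMF (k : ℕ) (f : ℂ → ℂ) : Prop where
  holo : DifferentiableOn ℂ f {τ | UHP τ}
  transf : ∀ M : Matrix.SpecialLinearGroup (Fin 2) ℤ, ∀ τ : ℂ, UHP τ →
      f ((Ma M * τ + Mb M) / (Mc M * τ + Md M)) = (Mc M * τ + Md M) ^ k * f τ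
  bounded : ∃ A B : ℝ, ∀ τ : ℂ, B ≤ τ.im → ‖f τ‖ ≤ A

/-- Cusp form of weight `k` for `SL(2,ℤ)`. -/
structure IsCF (k : ℕ) (f : ℂ → ℂ) : Prop where
  holo : DifferentiableOn ℂ f {τ | UHP τ}
  transf : ∀ M : Matrix.SpecialLinearGroup (Fin 2) ℤ, ∀ τ : ℂ, UHP τ →
      f ((Ma M * τ + Mb M) / (Mc M * τ + Md M)) = (Mc M * τ + Md M) ^ k * f τ
  decay : ∀ ε : ℝ, 0 < ε → ∃ B : ℝ, ∀ τ : ℂ, B ≤ τ.im → ‖f τ‖ ≤ ε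

/-- `M_w(SL(2,ℤ), ω̄)` for the character `ω` of `SL(2,ℤ)` with `ω(T) = ω(S) = i`:
holomorphic functions on the upper half plane, bounded at infinity, with
`f|_w T = -i f` and `f|_w S = -i f`. -/
structure IsMFOmegaBar (w : ℕ) (f : ℂ → ℂ) : Prop where
  holo : DifferentiableOn ℂ f {τ | UHP τ}
  transT : ∀ τ : ℂ, UHP τ → f (τ + 1) = -Complex.I * f τ
  transS : ∀ τ : ℂ, UHP τ → f (-1 / τ) = -Complex.I * τ ^ w * f τ
  bounded : ∃ A B : ℝ, ∀ τ : ℂ, B ≤ τ.im → ‖f τ‖ ≤ A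

/-- Hermitian theta function `θ^H_{m,s}` of index `m` with characteristic
`s = (a + b i)/2 ∈ O_K^♯`; the sum is over `r = s + m (g₁ + g₂ i) ∈ s + m ℤ[i]`. -/
def thetaH (m : ℕ) (a b : ℤ) (τ z₁ z₂ : ℂ) : ℂ :=
  ∑' g : ℤ × ℤ,
    eC ((((a : ℂ) + 2 * m * g.1) ^ 2 + ((b : ℂ) + 2 * m * g.2) ^ 2) / (4 * m) * τ
      + (((a : ℂ) + 2 * m * g.1) + ((b : ℂ) + 2 * m * g.2) * Complex.I) / 2 * z₁
      + (((a : ℂ) + 2 * m * g.1) - ((b : ℂ) + 2 * m * g.2) * Complex.I) / 2 * z₂)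

/-- Classical theta function `θ_{m,μ}(τ,z) = Σ_{r ≡ μ mod 2m} e(r²τ/(4m) + r z)`. -/
def thetaJ (m : ℕ) (μ : ℤ) (τ z : ℂ) : ℂ :=
  ∑' g : ℤ, eC (((μ : ℂ) + 2 * m * g) ^ 2 / (4 * m) * τ + ((μ : ℂ) + 2 * m * g) * z)

/-- `h` is the family of theta components of `φ` (for index `m`): the `h_{a,b}` depend
only on `(a, b) mod 2m` and `φ = Σ_{s ∈ O_K^♯ / m O_K} h_s θ^H_{m,s}`. -/
def HasThetaDecomp (m : ℕ) (φ : ℂ → ℂ → ℂ → ℂ) (h : ℤ → ℤ → ℂ → ℂ) : Prop :=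
  (∀ (a b : ℤ) (τ : ℂ), h (a + 2 * m) b τ = h a b τ ∧ h a (b + 2 * m) τ = h a b τ) ∧
  ∀ τ z₁ z₂ : ℂ, UHP τ →
    φ τ z₁ z₂ = ∑ a ∈ Finset.range (2 * m), ∑ b ∈ Finset.range (2 * m),
      h (a : ℤ) (b : ℤ) τ * thetaH m (a : ℤ) (b : ℤ) τ z₁ z₂

/-- `ϑ₀(τ) = Σ_{r ∈ ℤ} e(r² τ)`. -/
def theta0C (τ : ℂ) : ℂ := ∑' r : ℤ, eC ((r : ℂ) ^ 2 * τ)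

/-- `ϑ₁(τ) = Σ_{r odd} e(r² τ / 4)`. -/
def theta1C (τ : ℂ) : ℂ := ∑' r : ℤ, eC ((2 * (r : ℂ) + 1) ^ 2 * τ / 4)

/-- `ξ = ϑ₁ ϑ₀' − ϑ₀ ϑ₁'`. -/
def xiC (τ : ℂ) : ℂ := theta1C τ * deriv theta0C τ - theta0C τ * deriv theta1C τ

/-- Taylor coefficient `χ_{α,β}(τ)` of `φ(τ, z₁, z₂)` around `z₁ = z₂ = 0`. -/
def chiHJF (φ : ℂ → ℂ → ℂ → ℂ) (α β : ℕ) (τ : ℂ) : ℂ :=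
  (1 / ((α.factorial : ℂ) * (β.factorial : ℂ))) *
    iteratedDeriv α (fun z₁ => iteratedDeriv β (fun z₂ => φ τ z₁ z₂) 0) 0

/-- `D₀ : J_{k,m} → M_k`, `ψ ↦ ψ(·, 0)`. -/
def D0J (ψ : ℂ → ℂ → ℂ) : ℂ → ℂ := fun τ => ψ τ 0

/-- `D₂ : J_{k,m} → S_{k+2}`, `D₂ψ = (2k/(2πi)²) ψ₂ − (2m/(2πi)) ψ₀'`, where `ψ_ν` are
the Taylor coefficients of `ψ` around `z = 0`. -/
def D2J (k m : ℕ) (ψ : ℂ → ℂ → ℂ) : ℂ → ℂ := fun τ =>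
  (2 * (k : ℂ) / (2 * (Real.pi : ℂ) * Complex.I) ^ 2) *
      ((1 / 2) * iteratedDeriv 2 (fun z => ψ τ z) 0)
    - (2 * (m : ℂ) / (2 * (Real.pi : ℂ) * Complex.I)) * deriv (fun t => ψ t 0) τ

/-- Normalized Eisenstein series `E₄`. -/
def E4C (τ : ℂ) : ℂ :=
  1 + 240 * ∑' n : ℕ, ((ArithmeticFunction.sigma 3) n : ℂ) * eC ((n : ℂ) * τ)

/-- Normalized Eisenstein series `E₆`. -/
def E6C (τ : ℂ) : ℂ :=
  1 - 504 * ∑' n : ℕ, ((ArithmeticFunction.sigma 5) n : ℂ) * eC ((n : ℂ) * τ)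

/-- `f` agrees on the upper half plane with a polynomial in `E₄` and `E₆²` that is
homogeneous of weight `k - v`, i.e. supported on `4a + 12b + v = k`. -/
def IsE4E6sqPoly (v k : ℕ) (f : ℂ → ℂ) : Prop :=
  ∃ lam : ℕ × ℕ → ℂ, ∀ τ : ℂ, UHP τ →
    f τ = ∑ p ∈ (Finset.range (k + 1) ×ˢ Finset.range (k + 1)).filter
        (fun p => 4 * p.1 + 12 * p.2 + v = k),
      lam p * E4C τ ^ p.1 * E6C τ ^ (2 * p.2)

/-- The slash action `φ|_{k,m} M` of `M ∈ SL(2,ℤ)` on functions `ℂ → ℂ → ℂ → ℂ`. -/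
def slashHJF (k m : ℕ) (φ : ℂ → ℂ → ℂ → ℂ) (M : Matrix.SpecialLinearGroup (Fin 2) ℤ)
    (τ z₁ z₂ : ℂ) : ℂ :=
  ((Mc M * τ + Md M) ^ k)⁻¹ *
    eC (-(m : ℂ) * Mc M * z₁ * z₂ / (Mc M * τ + Md M)) *
    φ ((Ma M * τ + Mb M) / (Mc M * τ + Md M)) (z₁ / (Mc M * τ + Md M)) (z₂ / (Mc M * τ + Md M))

/-- Hermitian Jacobi form of weight `k` and index `m` for the congruence subgroup `Γ₀(N)`,
with at each cusp a Fourier expansion supported on `(n, r) ∈ ℚ_{≥0} × O_K^♯`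
with `N(r) ≤ n m`. -/
structure IsHJFLevel (k m N : ℕ) (φ : ℂ → ℂ → ℂ → ℂ) : Prop where
  holo : DifferentiableOn ℂ (fun p : ℂ × ℂ × ℂ => φ p.1 p.2.1 p.2.2) {p | UHP p.1}
  transf : ∀ ε : ℂ, ε ∈ ({1, -1, Complex.I, -Complex.I} : Set ℂ) →
    ∀ M : Matrix.SpecialLinearGroup (Fin 2) ℤ, (N : ℤ) ∣ M.1 1 0 →
    ∀ τ z₁ z₂ : ℂ, UHP τ →
      φ ((Ma M * τ + Mb M) / (Mc M * τ + Md M))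
        (ε * z₁ / (Mc M * τ + Md M))
        ((starRingEnd ℂ) ε * z₂ / (Mc M * τ + Md M))
      = ε ^ k * (Mc M * τ + Md M) ^ k *
          eC ((m : ℂ) * Mc M * z₁ * z₂ / (Mc M * τ + Md M)) * φ τ z₁ z₂
  ellip : ∀ p q u v : ℤ, ∀ τ z₁ z₂ : ℂ, UHP τ →
      φ τ (z₁ + ((p : ℂ) + (q : ℂ) * Complex.I) * τ + ((u : ℂ) + (v : ℂ) * Complex.I))
          (z₂ + ((p : ℂ) - (q : ℂ) * Complex.I) * τ + ((u : ℂ) - (v : ℂ) * Complex.I))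
      = eC (-(m : ℂ) * (((p : ℂ) ^ 2 + (q : ℂ) ^ 2) * τ
          + ((p : ℂ) - (q : ℂ) * Complex.I) * z₁
          + ((p : ℂ) + (q : ℂ) * Complex.I) * z₂)) * φ τ z₁ z₂
  cusp : ∀ M : Matrix.SpecialLinearGroup (Fin 2) ℤ,
      ∃ c : ℚ → ℤ → ℤ → ℂ,
        (∀ (n : ℚ) (a b : ℤ),
          ¬ (0 ≤ n ∧ ((a : ℚ) ^ 2 + (b : ℚ) ^ 2) ≤ 4 * n * m) → c n a b = 0) ∧
        ∀ τ z₁ z₂ : ℂ, UHP τ →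
          HasSum (fun p : ℚ × ℤ × ℤ => c p.1 p.2.1 p.2.2 *
            eC ((p.1 : ℂ) * τ + (((p.2.1 : ℂ) + (p.2.2 : ℂ) * Complex.I) / 2) * z₁
              + (((p.2.1 : ℂ) - (p.2.2 : ℂ) * Complex.I) / 2) * z₂))
            (slashHJF k m φ M τ z₁ z₂)

/-- Theta constant `x`. -/
def thConstX (τ : ℂ) : ℂ := ∑' n : ℤ, eC ((n : ℂ) ^ 2 * τ / 2)

/-- Theta constant `y`. -/
def thConstY (τ : ℂ) : ℂ := ∑' n : ℤ, (-1 : ℂ) ^ n * eC ((n : ℂ) ^ 2 * τ / 2)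

/-- Theta constant `z`. -/
def thConstZ (τ : ℂ) : ℂ := ∑' n : ℤ, eC (((n : ℂ) + 1 / 2) ^ 2 * τ / 2)

/-! ### Basic facts on `eC` -/

lemma eC_add (a b : ℂ) : eC (a + b) = eC a * eC b := by
  simp only [eC, mul_add, Complex.exp_add]

lemma eC_zero : eC 0 = 1 := by simp [eC]

lemma eC_ne_zero (a : ℂ) : eC a ≠ 0 := Complex.exp_ne_zero _

lemma eC_int (n : ℤ) : eC n = 1 := by
  rw [eC, Complex.exp_eq_one_iff]; exact ⟨n, by ring⟩

lemma eC_half : eC (1 / 2) = -1 := by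
  rw [eC, show 2 * (Real.pi : ℂ) * I * (1 / 2) = Real.pi * I by ring, Complex.exp_pi_mul_I]

lemma eC_eq_int {a b : ℂ} (n : ℤ) (h : a = b + n) : eC a = eC b := by
  rw [h, eC_add, eC_int, mul_one]

lemma eC_eq_half {a b : ℂ} (n : ℤ) (h : a = b + 1 / 2 + n) : eC a = -eC b := by
  rw [h, eC_add, eC_int, eC_add, eC_half]; ring

lemma norm_eC (a : ℂ) : ‖eC a‖ = Real.exp (-2 * Real.pi * a.im) := by
  rw [eC, Complex.norm_exp]; congr 1; simp

lemma differentiable_eC : Differentiable ℂ eC := by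
  unfold eC; fun_prop

lemma eC_pow (a : ℂ) (n : ℕ) : eC a ^ n = eC (n * a) := by
  rw [eC, eC, ← Complex.exp_nat_mul]; congr 1; ring

/-! ### Theta functions with characteristics -/

def th0 (τ z : ℂ) : ℂ := jacobiTheta₂ z τ
def th1 (τ z : ℂ) : ℂ := jacobiTheta₂ (z + 1 / 2) τ
def th2 (τ z : ℂ) : ℂ := eC (τ / 8 + z / 2) * jacobiTheta₂ (z + τ / 2) τ
def th3 (τ z : ℂ) : ℂ := eC (τ / 8 + z / 2) * jacobiTheta₂ (z + τ / 2 + 1 / 2) τ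

lemma jt_add_tau (z τ : ℂ) : jacobiTheta₂ (z + τ) τ = eC (-τ / 2 - z) * jacobiTheta₂ z τ := by
  rw [jacobiTheta₂_add_left', eC]; congr 2; ring

/-- quasi-periodicity of type `(σ₁, σ₂)` -/
structure QP (τ s t : ℂ) (G : ℂ → ℂ) : Prop where
  one : ∀ z, G (z + 1) = s * G z
  tau : ∀ z, G (z + τ) = t * eC (-τ / 2 - z) * G z

lemma qp_th0 (τ : ℂ) : QP τ 1 1 (th0 τ) where
  one z := by simp [th0, jacobiTheta₂_add_left]
  tau z := by simp [th0, jt_add_tau]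

lemma qp_th1 (τ : ℂ) : QP τ 1 (-1) (th1 τ) where
  one z := by
    simp only [th1]; rw [show z + 1 + 1 / 2 = z + 1 / 2 + 1 by ring, jacobiTheta₂_add_left]; ring
  tau z := by
    simp only [th1]; rw [show z + τ + 1 / 2 = z + 1 / 2 + τ by ring, jt_add_tau,
      eC_eq_half (b := -τ / 2 - z) (-1) (by push_cast; ring)]; ring

lemma qp_th2 (τ : ℂ) : QP τ (-1) 1 (th2 τ) where
  one z := by
    simp only [th2]; rw [show z + 1 + τ / 2 = z + τ / 2 + 1 by ring, jacobiTheta₂_add_left,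
      eC_eq_half (b := τ / 8 + z / 2) 0 (by push_cast; ring)]; ring
  tau z := by
    simp only [th2]; rw [show z + τ + τ / 2 = z + τ / 2 + τ by ring, jt_add_tau, ← mul_assoc,
      ← eC_add, one_mul, ← mul_assoc, ← eC_add]; congr 2; ring

lemma qp_th3 (τ : ℂ) : QP τ (-1) (-1) (th3 τ) where
  one z := by
    simp only [th3]; rw [show z + 1 + τ / 2 + 1 / 2 = z + τ / 2 + 1 / 2 + 1 by ring,
      jacobiTheta₂_add_left,
      eC_eq_half (b := τ / 8 + z / 2) 0 (by push_cast; ring)]; ring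
  tau z := by
    simp only [th3]; rw [show z + τ + τ / 2 + 1 / 2 = z + τ / 2 + 1 / 2 + τ by ring, jt_add_tau,
      ← mul_assoc, ← eC_add, ← mul_assoc, mul_assoc (-1), ← eC_add,
      eC_eq_half (b := -τ / 2 - z + (τ / 8 + z / 2)) (-1) (by push_cast; ring)]; ring

lemma th0_neg (τ z : ℂ) : th0 τ (-z) = th0 τ z := by simp [th0]
lemma th1_neg (τ z : ℂ) : th1 τ (-z) = th1 τ z := by
  simp only [th1]; rw [← jacobiTheta₂_neg_left, ← jacobiTheta₂_add_left]; congr 1; ring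
lemma th2_neg (τ z : ℂ) : th2 τ (-z) = th2 τ z := by
  simp only [th2]; rw [← jacobiTheta₂_neg_left (-z + τ / 2),
    show z + τ / 2 = -(-z + τ / 2) + τ by ring, jt_add_tau, ← mul_assoc, ← eC_add]
  congr 2; ring
lemma th3_neg (τ z : ℂ) : th3 τ (-z) = -th3 τ z := by
  simp only [th3]; rw [← jacobiTheta₂_neg_left (-z + τ / 2 + 1 / 2),
    show z + τ / 2 + 1 / 2 = -(-z + τ / 2 + 1 / 2) + 1 + τ by ring, jt_add_tau,
    jacobiTheta₂_add_left, ← mul_assoc, ← eC_add,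
    eC_eq_half (a := τ / 8 + z / 2 + (-τ / 2 - (-(-z + τ / 2 + 1 / 2) + 1)))
      (b := τ / 8 + -z / 2) (-1) (by push_cast; ring)]; ring

lemma jt_S {τ : ℂ} (hτ : UHP τ) (z : ℂ) : jacobiTheta₂ (z / τ) (-1 / τ) =
    (-I * τ) ^ (1 / 2 : ℂ) * eC (z ^ 2 / (2 * τ)) * jacobiTheta₂ z τ := by
  have h0 : τ ≠ 0 := by rintro rfl; simp [UHP] at hτ
  have h1 : (-I * τ) ^ (1 / 2 : ℂ) ≠ 0 := by
    rw [Ne, Complex.cpow_eq_zero_iff]; simp [h0]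
  rw [jacobiTheta₂_functional_equation z τ]
  have : cexp (-Real.pi * I * z ^ 2 / τ) = eC (-(z ^ 2 / (2 * τ))) := by
    rw [eC]; congr 1; field_simp
  rw [this]
  have h2 : eC (z ^ 2 / (2 * τ)) * eC (-(z ^ 2 / (2 * τ))) = 1 := by
    rw [← eC_add, add_neg_cancel, eC_zero]
  have h3 : (-I * τ) ^ (1 / 2 : ℂ) * (1 / (-I * τ) ^ (1 / 2 : ℂ)) = 1 := by
    rw [mul_one_div, div_self h1]
  generalize (-I * τ) ^ (1 / 2 : ℂ) = r at *
  generalize eC (z ^ 2 / (2 * τ)) = A at *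
  generalize eC (-(z ^ 2 / (2 * τ))) = B at *
  generalize 1 / r = r' at *
  linear_combination (- jacobiTheta₂ (z / τ) (-1 / τ)) * (r * r' * h2 + h3)

lemma th0_S {τ : ℂ} (hτ : UHP τ) (z : ℂ) : th0 (-1 / τ) (z / τ) =
    (-I * τ) ^ (1 / 2 : ℂ) * eC (z ^ 2 / (2 * τ)) * th0 τ z := jt_S hτ z

lemma th1_S {τ : ℂ} (hτ : UHP τ) (z : ℂ) : th1 (-1 / τ) (z / τ) =
    (-I * τ) ^ (1 / 2 : ℂ) * eC (z ^ 2 / (2 * τ)) * th2 τ z := by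
  have h0 : τ ≠ 0 := by rintro rfl; simp [UHP] at hτ
  simp only [th1, th2]
  rw [show z / τ + 1 / 2 = (z + τ / 2) / τ by field_simp, jt_S hτ,
    show (z + τ / 2) ^ 2 / (2 * τ) = z ^ 2 / (2 * τ) + (τ / 8 + z / 2) by field_simp; ring, eC_add]
  ring

lemma th2_S {τ : ℂ} (hτ : UHP τ) (z : ℂ) : th2 (-1 / τ) (z / τ) =
    (-I * τ) ^ (1 / 2 : ℂ) * eC (z ^ 2 / (2 * τ)) * th1 τ z := by
  have h0 : τ ≠ 0 := by rintro rfl; simp [UHP] at hτ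
  simp only [th1, th2]
  rw [show z / τ + -1 / τ / 2 = (z - 1 / 2) / τ by field_simp; ring, jt_S hτ,
    show z + 1 / 2 = z - 1 / 2 + 1 by ring, jacobiTheta₂_add_left,
    show z ^ 2 / (2 * τ) = -1 / τ / 8 + z / τ / 2 + (z - 1 / 2) ^ 2 / (2 * τ) by field_simp; ring,
    eC_add (_ + _)]
  ring

lemma jt_T (z τ : ℂ) : jacobiTheta₂ z (τ + 1) = jacobiTheta₂ (z + 1 / 2) τ := by
  refine tsum_congr (fun n ↦ ?_)
  simp only [jacobiTheta₂_term]
  rw [Complex.exp_eq_exp_iff_exists_int]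
  obtain ⟨m, hm⟩ := Int.even_mul_succ_self (n - 1)
  refine ⟨m, ?_⟩
  have : ((n : ℂ) - 1) * n = m + m := by
    have := congrArg (Int.cast : ℤ → ℂ) hm
    push_cast at this; linear_combination this
  linear_combination (Real.pi * I) * this

lemma th0_T (τ z : ℂ) : th0 (τ + 1) z = th1 τ z := jt_T z τ
lemma th1_T (τ z : ℂ) : th1 (τ + 1) z = th0 τ z := by
  simp only [th1, th0]; rw [jt_T, ← jacobiTheta₂_add_left z]; congr 1; ring
lemma th2_T (τ z : ℂ) : th2 (τ + 1) z = eC (1 / 8) * th2 τ z := by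
  simp only [th2]
  rw [jt_T, ← jacobiTheta₂_add_left (z + τ / 2), ← mul_assoc, ← eC_add]; congr 2 <;> ring

lemma QP.shift {τ s t : ℂ} {G : ℂ → ℂ} (h : QP τ s t G) (hs : s * s = 1) (ht : t * t = 1)
    (p q : ℤ) (z : ℂ) : G (z + p * τ + q) =
      s ^ q * t ^ p * eC (-((p : ℂ) ^ 2 * τ / 2 + p * z)) * G z := by
  have hs0 : s ≠ 0 := by rintro rfl; simp at hs
  have ht0 : t ≠ 0 := by rintro rfl; simp at ht
  have h1 : ∀ (q : ℤ) (z : ℂ), G (z + q) = s ^ q * G z := by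
    intro q
    induction q using Int.induction_on with
    | zero => simp
    | succ n ih =>
      intro z; push_cast at ih ⊢
      rw [← add_assoc, h.one, ih, zpow_add₀ hs0]; simp; ring
    | pred n ih =>
      intro z; push_cast at ih ⊢
      have := h.one (z + (-n - 1))
      rw [show z + (-(n : ℂ) - 1) + 1 = z + -n by ring, ih] at this
      rw [zpow_sub₀ hs0, zpow_one]; field_simp; linear_combination -this
  have h2 : ∀ (p : ℤ) (z : ℂ), G (z + p * τ) =
      t ^ p * eC (-((p : ℂ) ^ 2 * τ / 2 + p * z)) * G z := by
    intro p
    induction p using Int.induction_on with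
    | zero => simp [eC_zero]
    | succ n ih =>
      intro z; push_cast at ih ⊢
      rw [show z + ((n : ℂ) + 1) * τ = z + n * τ + τ by ring, h.tau, ih, zpow_add₀ ht0, zpow_one,
        show -(((n : ℂ) + 1) ^ 2 * τ / 2 + (n + 1) * z) =
          (-τ / 2 - (z + n * τ)) + (-((n : ℂ) ^ 2 * τ / 2 + n * z)) by ring, eC_add]
      ring
    | pred n ih =>
      intro z; push_cast at ih ⊢
      have := h.tau (z + (-n - 1) * τ)
      rw [show z + (-(n : ℂ) - 1) * τ + τ = z + -n * τ by ring, ih] at this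
      have e1 : eC (-((-(n : ℂ)) ^ 2 * τ / 2 + -n * z)) =
          eC (-τ / 2 - (z + (-n - 1) * τ)) * eC (-((-(n : ℂ) - 1) ^ 2 * τ / 2 + (-n - 1) * z)) := by
        rw [← eC_add]; congr 1; ring
      rw [e1] at this
      have h3 := eC_ne_zero (-τ / 2 - (z + (-n - 1) * τ))
      rw [zpow_sub₀ ht0, zpow_one]
      apply mul_left_cancel₀ h3
      apply mul_left_cancel₀ ht0
      have h4 : t * (t ^ (-n : ℤ) / t) = t ^ (-n : ℤ) := by field_simp
      generalize t ^ (-n : ℤ) / t = r at *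
      generalize eC (-τ / 2 - (z + (-n - 1) * τ)) = A at *
      generalize eC (-((-(n : ℂ) - 1) ^ 2 * τ / 2 + (-n - 1) * z)) = B at *
      rw [← h4] at this
      linear_combination -this
  rw [h1, h2]; ring

/-! ### Uniqueness of theta functions -/

lemma int_shift {H : ℂ → ℂ} (hd : Differentiable ℂ H) (hp : ∀ z, H (z + 1) = H z) (τ : ℂ) :
    ∫ x in (0:ℝ)..1, H (x + τ) = ∫ x in (0:ℝ)..1, H x := by
  have h := Complex.integral_boundary_rect_eq_zero_of_differentiableOn H 0 (1 + τ.im * I)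
    hd.differentiableOn
  have e : ∀ y : ℝ, H (1 + y * I) = H (y * I) := fun y => by rw [add_comm, hp]
  simp only [Complex.zero_re, Complex.zero_im, Complex.add_re, Complex.add_im, Complex.mul_re,
    Complex.mul_im, Complex.ofReal_re, Complex.ofReal_im, Complex.I_re, Complex.I_im,
    Complex.one_re, Complex.one_im, mul_zero, mul_one, zero_mul, add_zero, zero_add, sub_zero,
    Complex.ofReal_zero, Complex.ofReal_one, e, add_sub_cancel_right] at h
  have hper : Function.Periodic (fun x : ℝ => H (x + τ.im * I)) 1 := by
    intro x; simp only [Complex.ofReal_add, Complex.ofReal_one]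
    rw [show (x : ℂ) + 1 + τ.im * I = x + τ.im * I + 1 by ring, hp]
  have h2 := hper.intervalIntegral_add_eq τ.re 0
  have h3 : ∫ x in (0:ℝ)..1, H (x + τ) = ∫ x in τ.re..τ.re + 1, H (x + τ.im * I) := by
    have := intervalIntegral.integral_comp_add_right (a := 0) (b := 1)
      (fun x : ℝ => H (x + τ.im * I)) τ.re
    rw [zero_add, add_comm 1] at this
    rw [← this]
    congr 1; ext x; congr 1
    conv_lhs => rw [← Complex.re_add_im τ]
    push_cast; ring
  rw [h3, h2, zero_add]
  exact (sub_eq_zero.mp h).symm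

def fc (G : ℂ → ℂ) (n : ℤ) : ℂ := ∫ x in (0:ℝ)..1, G x * eC (-(n * x))

lemma fc_zero_imp {K : ℂ → ℂ} (hd : Differentiable ℂ K) (hp : ∀ z, K (z + 1) = K z)
    (h : ∀ n, fc K n = 0) : ∀ z, K z = 0 := by
  have hper : Function.Periodic (fun x : ℝ => K x) 1 := by
    intro x; simp only [Complex.ofReal_add, Complex.ofReal_one]; rw [hp]
  have : Fact (0 < (1:ℝ)) := ⟨one_pos⟩
  let f : C(AddCircle (1:ℝ), ℂ) := ⟨hper.lift, by
    apply continuous_coinduced_dom.mpr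
    exact hd.continuous.comp Complex.continuous_ofReal⟩
  have hf : ∀ x : ℝ, f (x : AddCircle (1:ℝ)) = K x := fun x => hper.lift_coe x
  have hc : ∀ n, fourierCoeff f n = 0 := by
    intro n
    rw [fourierCoeff_eq_intervalIntegral _ n 0]
    have := h n
    rw [fc] at this
    simp only [one_div, inv_one, one_smul, zero_add]
    rw [← this]
    congr 1; ext x
    rw [hf, fourier_coe_apply, smul_eq_mul, mul_comm, eC]
    congr 2; push_cast; ring
  have hs : Summable (fourierCoeff f) := by
    rw [show fourierCoeff f = fun _ => 0 from funext hc]; exact summable_zero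
  have hz : ∀ x : ℝ, K x = 0 := by
    intro x
    have := has_pointwise_sum_fourier_series_of_summable hs (x : AddCircle (1:ℝ))
    simp only [hc, zero_smul] at this
    rw [← hf]; exact (hasSum_zero.unique this).symm
  -- identity theorem
  have ha : AnalyticOnNhd ℂ K Set.univ := fun z _ => hd.analyticAt z
  have : K = 0 := by
    apply ha.eq_of_frequently_eq (z₀ := 0) (g := 0) (fun z _ => analyticAt_const)
    rw [Filter.frequently_iff_seq_forall]
    refine ⟨fun n : ℕ => ((1 / ((n : ℝ) + 1) : ℝ) : ℂ), ?_, fun n => hz _⟩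
    rw [tendsto_nhdsWithin_iff]
    refine ⟨?_, Filter.Eventually.of_forall fun n => ?_⟩
    · rw [← Complex.ofReal_zero]
      exact (Complex.continuous_ofReal.tendsto 0).comp tendsto_one_div_add_atTop_nhds_zero_nat
    · simp only [Set.mem_compl_iff, Set.mem_singleton_iff, Complex.ofReal_eq_zero]
      positivity
  intro z; rw [this]; rfl

lemma fc_step {τ κ : ℂ} {G : ℂ → ℂ} (hd : Differentiable ℂ G) (hp : ∀ z, G (z + 1) = G z)
    (ht : ∀ z, G (z + τ) = κ * eC (-z) * G z) (n : ℤ) :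
    fc G n = κ * eC (-(n * τ)) * fc G (n + 1) := by
  have h := int_shift (H := fun z => G z * eC (-(n * z)))
    (hd.mul (differentiable_eC.comp (by fun_prop)))
    (fun z => by
      simp only [hp]
      rw [eC_eq_int (a := -(n * (z + 1))) (b := -(n * z)) (-n) (by push_cast; ring)]) τ
  rw [fc, fc, ← h, ← intervalIntegral.integral_const_mul]
  congr 1; ext x
  rw [ht, show -((n : ℂ) * (x + τ)) = -(n * τ) + -(n * x) by ring, eC_add,
    show -(((n + 1 : ℤ) : ℂ) * x) = -x + -(n * x) by push_cast; ring, eC_add]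
  ring

lemma theta_unique {τ κ : ℂ} (hκ : κ ≠ 0) {G₁ G₂ : ℂ → ℂ} (hd₁ : Differentiable ℂ G₁)
    (hd₂ : Differentiable ℂ G₂) (hp₁ : ∀ z, G₁ (z + 1) = G₁ z) (hp₂ : ∀ z, G₂ (z + 1) = G₂ z)
    (ht₁ : ∀ z, G₁ (z + τ) = κ * eC (-z) * G₁ z) (ht₂ : ∀ z, G₂ (z + τ) = κ * eC (-z) * G₂ z)
    (z w : ℂ) : G₁ z * G₂ w = G₁ w * G₂ z := by
  have key : ∀ K : ℂ → ℂ, Differentiable ℂ K → (∀ z, K (z + 1) = K z) →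
      (∀ z, K (z + τ) = κ * eC (-z) * K z) → fc K 0 = 0 → ∀ z, K z = 0 := by
    intro K hd hp ht h0
    refine fc_zero_imp hd hp fun n => ?_
    induction n using Int.induction_on with
    | zero => exact h0
    | succ n ih =>
      have := fc_step hd hp ht n
      rw [ih] at this
      simpa [hκ, eC_ne_zero] using this.symm
    | pred n ih =>
      have := fc_step hd hp ht (-n - 1)
      rwa [sub_add_cancel, ih, mul_zero] at this
  have hi : ∀ G : ℂ → ℂ, Differentiable ℂ G →
      IntervalIntegrable (fun x : ℝ => G x * eC (-((0 : ℤ) * x))) MeasureTheory.volume 0 1 := by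
    intro G hG
    apply Continuous.intervalIntegrable
    exact (hG.continuous.comp Complex.continuous_ofReal).mul
      (differentiable_eC.continuous.comp (by fun_prop))
  have hK := key (fun z => fc G₂ 0 * G₁ z - fc G₁ 0 * G₂ z) (by fun_prop)
    (fun z => by simp only [hp₁, hp₂]) (fun z => by simp only [ht₁, ht₂]; ring) (by
      have e : fc (fun z => fc G₂ 0 * G₁ z - fc G₁ 0 * G₂ z) 0 =
          fc G₂ 0 * fc G₁ 0 - fc G₁ 0 * fc G₂ 0 := by
        conv_rhs => rw [fc.eq_1 G₁, fc.eq_1 G₂]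
        rw [fc, ← intervalIntegral.integral_const_mul, ← intervalIntegral.integral_const_mul,
          ← intervalIntegral.integral_sub ((hi G₁ hd₁).const_mul _) ((hi G₂ hd₂).const_mul _)]
        congr 1; ext x
        simp only [fc]; ring
      rw [e]; ring)
  by_cases h1 : fc G₁ 0 = 0
  · simp [key G₁ hd₁ hp₁ ht₁ h1]
  · have a := hK z
    have b := hK w
    apply mul_left_cancel₀ h1
    linear_combination G₁ w * a - G₁ z * b

lemma QP.unique {τ s t : ℂ} (hs : s = 1 ∨ s = -1) (ht : t ≠ 0) {G₁ G₂ : ℂ → ℂ}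
    (hd₁ : Differentiable ℂ G₁) (hd₂ : Differentiable ℂ G₂) (h₁ : QP τ s t G₁) (h₂ : QP τ s t G₂)
    (z w : ℂ) : G₁ z * G₂ w = G₁ w * G₂ z := by
  rcases hs with rfl | rfl
  · refine theta_unique (τ := τ) (κ := t * eC (-τ / 2)) (mul_ne_zero ht (eC_ne_zero _)) hd₁ hd₂
      (fun z => by rw [h₁.one, one_mul]) (fun z => by rw [h₂.one, one_mul])
      (fun z => ?_) (fun z => ?_) z w
    · rw [h₁.tau, sub_eq_add_neg, eC_add]; ring
    · rw [h₂.tau, sub_eq_add_neg, eC_add]; ring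
  · have hh : ∀ z : ℂ, eC ((z + 1) / 2) = - eC (z / 2) := fun z =>
      eC_eq_half 0 (by push_cast; ring)
    have hh' : ∀ z : ℂ, eC ((z + τ) / 2) = eC (z / 2) * eC (τ / 2) := fun z => by
      rw [← eC_add]; congr 1; ring
    have hde : Differentiable ℂ (fun z => eC (z / 2)) := differentiable_eC.comp (by fun_prop)
    have := theta_unique (τ := τ) (κ := t * eC (-τ / 2) * eC (τ / 2))
      (G₁ := fun z => eC (z / 2) * G₁ z) (G₂ := fun z => eC (z / 2) * G₂ z)
      (mul_ne_zero (mul_ne_zero ht (eC_ne_zero _)) (eC_ne_zero _))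
      (hde.mul hd₁) (hde.mul hd₂)
      (fun z => by simp only [h₁.one, hh]; ring) (fun z => by simp only [h₂.one, hh]; ring)
      (fun z => by simp only [h₁.tau, hh', sub_eq_add_neg, eC_add]; ring)
      (fun z => by simp only [h₂.tau, hh', sub_eq_add_neg, eC_add]; ring) z w
    apply mul_left_cancel₀ (mul_ne_zero (eC_ne_zero (z / 2)) (eC_ne_zero (w / 2)))
    linear_combination this

/-! ### Limits at infinity and nonvanishing of theta constants -/

abbrev Linf : Filter ℂ := Filter.comap Complex.im Filter.atTop

lemma lim_series {ι : Type*} (f : ι → ℂ) (E : ι → ℝ) (hE : ∀ i, f i ≠ 0 → 0 ≤ E i)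
    (hs : Summable fun i => f i * eC (E i * I)) :
    Filter.Tendsto (fun τ : ℂ => ∑' i, f i * eC (E i * τ)) Linf
      (nhds (∑' i, if E i = 0 then f i else 0)) := by
  have hn : ∀ (τ : ℂ) i, ‖f i * eC (E i * τ)‖ = ‖f i‖ * Real.exp (-2 * Real.pi * (E i * τ.im)) := by
    intro τ i; rw [norm_mul, norm_eC]; simp
  refine tendsto_tsum_of_dominated_convergence (bound := fun i => ‖f i * eC (E i * I)‖)
    hs.norm (fun i => ?_) ?_
  · by_cases h0 : f i = 0
    · simpa [h0] using tendsto_const_nhds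
    rcases (hE i h0).eq_or_lt' with h | h
    · simpa [h, eC_zero] using tendsto_const_nhds
    · rw [if_neg h.ne', tendsto_zero_iff_norm_tendsto_zero]
      simp only [hn]
      rw [← mul_zero ‖f i‖]
      apply Filter.Tendsto.const_mul
      apply Real.tendsto_exp_atBot.comp
      have h1 : (fun τ : ℂ => -2 * Real.pi * (E i * τ.im)) =
          fun τ => (-2 * Real.pi * E i) * τ.im := by ext; ring
      rw [h1]
      refine Filter.Tendsto.const_mul_atTop_of_neg ?_ Filter.tendsto_comap
      have := mul_pos Real.pi_pos h
      linarith
  · have : ∀ᶠ τ : ℂ in Linf, 1 ≤ τ.im := Filter.tendsto_comap.eventually (Filter.eventually_ge_atTop 1)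
    filter_upwards [this] with τ hτ i
    rw [hn, hn]
    by_cases h0 : f i = 0
    · simp [h0]
    gcongr ?_ * ?_
    apply Real.exp_le_exp.mpr
    simp only [Complex.I_im]
    have := mul_nonneg (mul_nonneg Real.pi_pos.le (hE i h0)) (sub_nonneg.mpr hτ)
    nlinarith

lemma lim_jt (a b : ℂ) (c : ℝ) (hc : ∀ n : ℤ, 0 ≤ (n : ℝ) ^ 2 / 2 + n * c) (ha : a = c) :
    Filter.Tendsto (fun τ : ℂ => jacobiTheta₂ (a * τ + b) τ) Linf
      (nhds (∑' n : ℤ, if (n : ℝ) ^ 2 / 2 + n * c = 0 then eC (n * b) else 0)) := by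
  have key : ∀ τ : ℂ, jacobiTheta₂ (a * τ + b) τ =
      ∑' n : ℤ, eC (n * b) * eC (((n : ℝ) ^ 2 / 2 + n * c : ℝ) * τ) := by
    intro τ
    refine tsum_congr fun n => ?_
    rw [← eC_add, jacobiTheta₂_term, eC, ha]; congr 1; push_cast; ring
  simp only [key]
  refine lim_series (fun n : ℤ => eC (n * b)) _ (fun n _ => hc n) ?_
  have := (hasSum_jacobiTheta₂_term (a * I + b) (τ := I) (by simp)).summable
  refine this.congr fun n => ?_
  rw [← eC_add, jacobiTheta₂_term, eC, ha]; congr 1; push_cast; ring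

lemma lim_th0 : Filter.Tendsto (fun τ => th0 τ 0) Linf (nhds 1) := by
  have := lim_jt 0 0 0 (fun n => by rw [mul_zero, add_zero]; positivity) (by simp)
  simp only [zero_mul, add_zero, mul_zero, eC_zero] at this
  rwa [tsum_eq_single 0 (by intro n hn; simp [hn]), if_pos (by simp)] at this

lemma lim_th1 : Filter.Tendsto (fun τ => th1 τ 0) Linf (nhds 1) := by
  have := lim_jt 0 (1 / 2) 0 (fun n => by rw [mul_zero, add_zero]; positivity) (by simp)
  simp only [zero_mul, add_zero, mul_zero] at this
  rwa [tsum_eq_single 0 (by intro n hn; simp [hn]), if_pos (by simp), Int.cast_zero, zero_mul,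
    eC_zero] at this

lemma lim_th2 : Filter.Tendsto (fun τ : ℂ => jacobiTheta₂ (τ / 2) τ) Linf (nhds 2) := by
  have h0 : ∀ n : ℤ, 0 ≤ n * (n + 1) := fun n => by
    rcases le_or_gt 0 n with h | h
    · positivity
    · exact mul_nonneg_of_nonpos_of_nonpos (by lia) (by lia)
  have := lim_jt (1 / 2) 0 (1 / 2) (fun n => by
    have := h0 n
    have : (0 : ℝ) ≤ n * (n + 1) := by exact_mod_cast this
    nlinarith) (by simp)
  simp only [add_zero, mul_zero, eC_zero] at this
  rw [tsum_eq_sum (s := {0, -1}) (by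
    intro n hn
    simp only [Finset.mem_insert, Finset.mem_singleton, not_or] at hn
    rw [if_neg]
    intro h
    have h1 : (n : ℝ) * (n + 1) = 0 := by nlinarith
    have h2 : n * (n + 1) = 0 := by exact_mod_cast h1
    rcases mul_eq_zero.mp h2 with h | h
    · exact hn.1 h
    · exact hn.2 (by lia))] at this
  rw [Finset.sum_pair (by norm_num)] at this
  norm_num at this
  refine this.congr fun τ => ?_
  congr 1; ring

lemma diff_jt {τ : ℂ} (hτ : UHP τ) {E : Type*} [NormedAddCommGroup E] [NormedSpace ℂ E]
    {f g : E → ℂ} {x : E} (hf : DifferentiableAt ℂ f x) (hg : DifferentiableAt ℂ g x)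
    (hx : g x = τ) : DifferentiableAt ℂ (fun y => jacobiTheta₂ (f y) (g y)) x := by
  have h := (hasFDerivAt_jacobiTheta₂ (f x) (τ := g x) (by rw [hx]; exact hτ)).differentiableAt
  exact h.comp x (hf.prodMk hg)

lemma diffAt_eC {E : Type*} [NormedAddCommGroup E] [NormedSpace ℂ E]
    {f : E → ℂ} {x : E} (hf : DifferentiableAt ℂ f x) :
    DifferentiableAt ℂ (fun y => eC (f y)) x :=
  (differentiable_eC _).comp x hf

section
variable {E : Type*} [NormedAddCommGroup E] [NormedSpace ℂ E] {f g : E → ℂ} {x : E}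

lemma diff_th0 (hg : DifferentiableAt ℂ g x) (hf : DifferentiableAt ℂ f x) (hx : UHP (g x)) :
    DifferentiableAt ℂ (fun y => th0 (g y) (f y)) x := diff_jt hx hf hg rfl
lemma diff_th1 (hg : DifferentiableAt ℂ g x) (hf : DifferentiableAt ℂ f x) (hx : UHP (g x)) :
    DifferentiableAt ℂ (fun y => th1 (g y) (f y)) x := diff_jt hx (by fun_prop) hg rfl
lemma diff_th2 (hg : DifferentiableAt ℂ g x) (hf : DifferentiableAt ℂ f x) (hx : UHP (g x)) :
    DifferentiableAt ℂ (fun y => th2 (g y) (f y)) x :=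
  (diffAt_eC (by fun_prop)).mul (diff_jt hx (by fun_prop) hg rfl)
lemma diff_th3 (hg : DifferentiableAt ℂ g x) (hf : DifferentiableAt ℂ f x) (hx : UHP (g x)) :
    DifferentiableAt ℂ (fun y => th3 (g y) (f y)) x :=
  (diffAt_eC (by fun_prop)).mul (diff_jt hx (by fun_prop) hg rfl)
end

def X8 (τ : ℂ) : ℂ := (th0 τ 0 * th1 τ 0 * th2 τ 0) ^ 8

lemma X8_T (τ : ℂ) : X8 (τ + 1) = X8 τ := by
  have h : eC (1 / 8) ^ 8 = 1 := by
    rw [eC_pow]; exact (eC_eq_int 1 (by push_cast; ring)).trans eC_zero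
  simp only [X8, th0_T, th1_T, th2_T]
  linear_combination (th0 τ 0 * th1 τ 0 * th2 τ 0) ^ 8 * h

lemma X8_S {τ : ℂ} (hτ : UHP τ) : X8 (-1 / τ) = τ ^ 12 * X8 τ := by
  have h0 : τ ≠ 0 := by rintro rfl; simp [UHP] at hτ
  have a := th0_S hτ 0
  have b := th1_S hτ 0
  have c := th2_S hτ 0
  simp only [zero_div, ne_eq, OfNat.ofNat_ne_zero, not_false_eq_true, zero_pow, eC_zero,
    mul_one] at a b c
  have h2 : ((-I * τ) ^ (1 / 2 : ℂ)) ^ 2 = -I * τ := by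
    rw [← Complex.cpow_nat_mul]; norm_num
  have h : ((-I * τ) ^ (1 / 2 : ℂ)) ^ 24 = τ ^ 12 := by
    rw [show 24 = 2 * 12 by norm_num, pow_mul, h2, mul_pow, Even.neg_pow (by decide),
      show 12 = 4 * 3 by norm_num, pow_mul, I_pow_four]; ring
  rw [X8, X8, a, b, c, ← h]; ring

open UpperHalfPlane ModularForm MatrixGroups in
def XCF : CuspForm 𝒮ℒ 12 :=
  have hS : ((fun z : ℍ => X8 z) ∣[(12 : ℤ)] ModularGroup.S) = (fun z : ℍ => X8 z) := by
    ext z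
    rw [SL_slash_apply, UpperHalfPlane.modular_S_smul]
    have h0 := UpperHalfPlane.ne_zero z
    have := X8_S (τ := z) z.2
    rw [show -1 / (z : ℂ) = -(z : ℂ)⁻¹ by field_simp] at this
    suffices X8 (-(z : ℂ)⁻¹) * ((z : ℂ) ^ 12)⁻¹ = X8 z by
      have hd : denom ModularGroup.S z = z := ModularGroup.denom_S z
      rw [hd]
      simpa using this
    rw [this]; field_simp
  have hT : ((fun z : ℍ => X8 z) ∣[(12 : ℤ)] ModularGroup.T) = (fun z : ℍ => X8 z) := by
    ext z
    rw [SL_slash_apply, modular_T_smul]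
    have := X8_T z
    rw [add_comm] at this
    have hd : denom ModularGroup.T z = 1 := by
      rw [ModularGroup.denom_apply]; simp [ModularGroup.T]
    rw [hd]
    simp [this]
  { toFun := fun z => X8 z
    slash_action_eq' := fun A hA => by
      obtain ⟨A, rfl⟩ := hA
      exact SlashInvariantForm.slash_action_generators_SL2Z hS hT A
    holo' := by
      rw [UpperHalfPlane.mdifferentiable_iff]
      refine DifferentiableOn.congr (f := X8) (fun z hz ↦ ?_) fun z hz ↦ ?_
      · apply DifferentiableAt.differentiableWithinAt
        exact (((diff_th0 (g := fun z => z) (by fun_prop) (by fun_prop) hz).mul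
          (diff_th1 (g := fun z => z) (by fun_prop) (by fun_prop) hz)).mul
          (diff_th2 (g := fun z => z) (by fun_prop) (by fun_prop) hz)).pow 8
      · simp [ofComplex_apply_of_im_pos hz]
    zero_at_cusps' := fun hc => by
      rw [Subgroup.IsArithmetic.isCusp_iff_isCusp_SL2Z] at hc
      rw [OnePoint.isZeroAt_iff_forall_SL2Z hc]
      intro γ _
      rw [SlashInvariantForm.slash_action_generators_SL2Z hS hT]
      have h1 : Filter.Tendsto (fun z : ℍ => (z : ℂ)) atImInfty Linf := by
        rw [Filter.tendsto_comap_iff]; exact Filter.tendsto_comap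
      have h2 : Filter.Tendsto X8 Linf (nhds 0) := by
        have e : Filter.Tendsto (fun τ : ℂ => eC (τ / 8)) Linf (nhds 0) := by
          have := lim_series (fun _ : Unit => (1 : ℂ)) (fun _ => (1 / 8 : ℝ)) (by simp)
            Summable.of_finite
          simp only [tsum_fintype, Finset.univ_unique, Finset.sum_const, Finset.card_singleton,
            one_smul, one_mul] at this
          norm_num at this
          refine this.congr fun τ => ?_
          congr 1; ring
        have := ((lim_th0.mul lim_th1).mul (e.mul lim_th2)).pow 8
        norm_num at this
        refine this.congr fun τ => ?_
        simp [X8, th2]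
      exact h2.comp h1 }

lemma X8_ne_zero {τ : ℂ} (hτ : UHP τ) : X8 τ ≠ 0 := by
  obtain ⟨c, hc⟩ := CuspForm.exists_smul_discriminant_of_weight_eq_twelve XCF
  have hX : ∀ z : UpperHalfPlane, X8 z = c * ModularForm.discriminant z := by
    intro z
    have := congrArg (fun f : CuspForm _ 12 => f z) hc
    exact this.symm
  have hc0 : c ≠ 0 := by
    rintro rfl
    have h1 := ((lim_th0.mul lim_th1).mul lim_th2)
    have h2 : ∀ᶠ τ : ℂ in Linf, 0 < τ.im :=
      Filter.tendsto_comap.eventually (Filter.eventually_gt_atTop 0)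
    have hne : Linf.NeBot := by
      refine Filter.comap_neBot fun t ht => ?_
      obtain ⟨a, ha⟩ := Filter.mem_atTop_sets.mp ht
      exact ⟨a * I, by simpa using ha a le_rfl⟩
    have h3 := h1.eventually_ne (by norm_num : (1 : ℂ) * 1 * 2 ≠ 0)
    obtain ⟨τ, h4, h5⟩ := (h2.and h3).exists
    have := hX ⟨τ, h4⟩
    rw [zero_mul] at this
    simp only [X8, th2] at this
    have h6 := pow_eq_zero_iff (by norm_num) |>.mp this
    rw [zero_add] at h6
    apply h5
    have := eC_ne_zero (τ / 8 + 0 / 2)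
    apply mul_left_cancel₀ this
    linear_combination h6
  rw [hX ⟨τ, hτ⟩]
  exact mul_ne_zero hc0 (ModularForm.discriminant_ne_zero _)

lemma th0_ne {τ : ℂ} (hτ : UHP τ) : th0 τ 0 ≠ 0 := fun h => X8_ne_zero hτ (by simp [X8, h])
lemma th1_ne {τ : ℂ} (hτ : UHP τ) : th1 τ 0 ≠ 0 := fun h => X8_ne_zero hτ (by simp [X8, h])
lemma th2_ne {τ : ℂ} (hτ : UHP τ) : th2 τ 0 ≠ 0 := fun h => X8_ne_zero hτ (by simp [X8, h])
lemma th3_ne {τ : ℂ} (hτ : UHP τ) : th3 τ (-(τ / 2 + 1 / 2)) ≠ 0 := by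
  rw [th3, show -(τ / 2 + 1 / 2) + τ / 2 + 1 / 2 = 0 by ring]
  exact mul_ne_zero (eC_ne_zero _) (th0_ne hτ)

/-! ### Decomposition -/

structure DH (τ : ℂ) (f : ℂ → ℂ) : Prop where
  diff : Differentiable ℂ f
  two : ∀ v, f (v + 2) = f v
  tau : ∀ v, f (v + 2 * τ) = eC (-2 * τ - 2 * v) * f v

def PJ (τ s t : ℂ) (f : ℂ → ℂ) (v : ℂ) : ℂ :=
  (f v + s * f (v + 1) + t * (eC (τ / 2 + v) * f (v + τ))
    + s * t * (eC (τ / 2 + v) * f (v + τ + 1))) / 4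

lemma PJ_sum (τ : ℂ) (f : ℂ → ℂ) (v : ℂ) :
    f v = PJ τ 1 1 f v + PJ τ 1 (-1) f v + PJ τ (-1) 1 f v + PJ τ (-1) (-1) f v := by
  simp only [PJ]; ring

lemma PJ_qp {τ s t : ℂ} {f : ℂ → ℂ} (h : DH τ f) (hs : s * s = 1) (ht : t * t = 1) :
    QP τ s t (PJ τ s t f) where
  one z := by
    simp only [PJ]
    rw [show z + 1 + 1 = z + 2 by ring, show z + 1 + τ + 1 = z + τ + 2 by ring, h.two, h.two,
      show z + 1 + τ = z + τ + 1 by ring,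
      eC_eq_int (a := τ / 2 + (z + 1)) (b := τ / 2 + z) 1 (by push_cast; ring)]
    linear_combination (-(f (z + 1)) / 4 - t * (eC (τ / 2 + z) * f (z + τ + 1)) / 4) * hs
  tau z := by
    simp only [PJ]
    have e1 : eC (τ / 2 + (z + τ)) * eC (-2 * τ - 2 * z) = eC (-τ / 2 - z) := by
      rw [← eC_add]; congr 1; ring
    have e2 : eC (-τ / 2 - z) * eC (τ / 2 + z) = 1 := by
      rw [← eC_add, ← eC_zero]; congr 1; ring
    rw [show z + τ + τ = z + 2 * τ by ring, show z + 2 * τ + 1 = z + 1 + 2 * τ by ring, h.tau,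
      h.tau, eC_eq_int (a := -2 * τ - 2 * (z + 1)) (b := -2 * τ - 2 * z) (-2) (by push_cast; ring)]
    generalize eC (τ / 2 + (z + τ)) = A at *
    generalize eC (-2 * τ - 2 * z) = B at *
    generalize eC (-τ / 2 - z) = C at *
    generalize eC (τ / 2 + z) = D at *
    linear_combination (t * f z / 4 + s * t * f (z + 1) / 4) * e1
      - (t * t * f (z + τ) / 4 + t * t * s * f (z + τ + 1) / 4) * e2
      - (f (z + τ) / 4 + s * f (z + τ + 1) / 4) * ht

lemma PJ_diff {τ s t : ℂ} {f : ℂ → ℂ} (h : Differentiable ℂ f) :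
    Differentiable ℂ (PJ τ s t f) := by
  have he := differentiable_eC
  unfold PJ
  fun_prop

lemma dth0 {τ : ℂ} (hτ : UHP τ) : Differentiable ℂ (th0 τ) := fun z =>
  diff_th0 (g := fun _ => τ) (f := fun z => z) (by fun_prop) (by fun_prop) hτ
lemma dth1 {τ : ℂ} (hτ : UHP τ) : Differentiable ℂ (th1 τ) := fun z =>
  diff_th1 (g := fun _ => τ) (f := fun z => z) (by fun_prop) (by fun_prop) hτ
lemma dth2 {τ : ℂ} (hτ : UHP τ) : Differentiable ℂ (th2 τ) := fun z =>
  diff_th2 (g := fun _ => τ) (f := fun z => z) (by fun_prop) (by fun_prop) hτ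
lemma dth3 {τ : ℂ} (hτ : UHP τ) : Differentiable ℂ (th3 τ) := fun z =>
  diff_th3 (g := fun _ => τ) (f := fun z => z) (by fun_prop) (by fun_prop) hτ

section
variable {τ : ℂ} (hτ : UHP τ) {f : ℂ → ℂ} (h : DH τ f)

lemma PJ_th0 (hτ : UHP τ) (h : DH τ f) (v w : ℂ) : PJ τ 1 1 f v * th0 τ w = PJ τ 1 1 f w * th0 τ v :=
  QP.unique (by simp) (by simp) (PJ_diff h.diff) (dth0 hτ) (PJ_qp h (by simp) (by simp))
    (qp_th0 τ) v w
lemma PJ_th1 (hτ : UHP τ) (h : DH τ f) (v w : ℂ) :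
    PJ τ 1 (-1) f v * th1 τ w = PJ τ 1 (-1) f w * th1 τ v :=
  QP.unique (by simp) (by simp) (PJ_diff h.diff) (dth1 hτ) (PJ_qp h (by simp) (by simp))
    (qp_th1 τ) v w
lemma PJ_th2 (hτ : UHP τ) (h : DH τ f) (v w : ℂ) :
    PJ τ (-1) 1 f v * th2 τ w = PJ τ (-1) 1 f w * th2 τ v :=
  QP.unique (by simp) (by simp) (PJ_diff h.diff) (dth2 hτ) (PJ_qp h (by simp) (by simp))
    (qp_th2 τ) v w
lemma PJ_th3 (hτ : UHP τ) (h : DH τ f) (v w : ℂ) :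
    PJ τ (-1) (-1) f v * th3 τ w = PJ τ (-1) (-1) f w * th3 τ v :=
  QP.unique (by simp) (by simp) (PJ_diff h.diff) (dth3 hτ) (PJ_qp h (by simp) (by simp))
    (qp_th3 τ) v w
end

lemma PJ_even {τ : ℂ} (hτ : UHP τ) {f : ℂ → ℂ} (h : DH τ f) (he : ∀ v, f (-v) = f v) (v : ℂ) :
    PJ τ (-1) (-1) f v = 0 := by
  have hev : ∀ v, PJ τ (-1) (-1) f (-v) = PJ τ (-1) (-1) f v := by
    intro v
    simp only [PJ]
    have e1 : f (-v + 1) = f (v + 1) := by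
      rw [← he, ← h.two]; congr 1; ring
    have e2 : eC (τ / 2 + -v) * f (-v + τ) = eC (τ / 2 + v) * f (v + τ) := by
      rw [← he (-v + τ), show v + τ = -(-v + τ) + 2 * τ by ring, h.tau, ← mul_assoc, ← eC_add]
      congr 2; ring
    have e3 : eC (τ / 2 + -v) * f (-v + τ + 1) = eC (τ / 2 + v) * f (v + τ + 1) := by
      rw [← he (-v + τ + 1), ← h.two, show v + τ + 1 = -(-v + τ + 1) + 2 + 2 * τ by ring, h.tau,
        ← mul_assoc, ← eC_add]
      congr 1
      exact eC_eq_int 2 (by push_cast; ring)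
    rw [he, e1, e2, e3]
  have h1 := PJ_th3 hτ h v (-(τ / 2 + 1 / 2))
  have h2 := PJ_th3 hτ h (-v) (-(τ / 2 + 1 / 2))
  rw [hev, th3_neg τ v] at h2
  have : PJ τ (-1) (-1) f v * th3 τ (-(τ / 2 + 1 / 2)) = 0 := by linear_combination (h1 + h2) / 2
  exact (mul_eq_zero.mp this).resolve_right (th3_ne hτ)

lemma decomp_even {τ : ℂ} (hτ : UHP τ) {f : ℂ → ℂ} (h : DH τ f) (he : ∀ v, f (-v) = f v) (v : ℂ) :
    f v = PJ τ 1 1 f 0 / th0 τ 0 * th0 τ v + PJ τ 1 (-1) f 0 / th1 τ 0 * th1 τ v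
      + PJ τ (-1) 1 f 0 / th2 τ 0 * th2 τ v := by
  have := PJ_sum τ f v
  rw [PJ_even hτ h he] at this
  have h0 := PJ_th0 hτ h v 0
  have h1 := PJ_th1 hτ h v 0
  have h2 := PJ_th2 hτ h v 0
  have n0 := th0_ne hτ
  have n1 := th1_ne hτ
  have n2 := th2_ne hτ
  rw [this, div_mul_eq_mul_div, div_mul_eq_mul_div, div_mul_eq_mul_div, ← h0, ← h1, ← h2]
  field_simp
  ring

lemma HasSum_of_eq {ι : Type*} {f g : ι → ℂ} {a : ℂ} (h : HasSum f a) (hfg : ∀ i, g i = f i) :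
    HasSum g a := by
  rwa [show g = f from funext hfg]

/-! ### Restriction is a Jacobi form -/

lemma restr_JF (k : ℕ) (φ : ℂ → ℂ → ℂ → ℂ) (h : IsHJF k 1 φ) :
    IsJF k 2 (fun τ z => φ τ ((1 + Complex.I) * z) ((1 - Complex.I) * z)) where
  holo := by
    have hm : Differentiable ℂ (fun p : ℂ × ℂ => (p.1, (1 + I) * p.2, (1 - I) * p.2)) := by
      fun_prop
    exact h.holo.comp hm.differentiableOn (fun p hp => hp)
  transf M τ z hτ := by
    have := h.transf 1 (by simp) M τ ((1 + I) * z) ((1 - I) * z) hτ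
    simp only [one_mul, map_one, one_pow, Nat.cast_one] at this
    rw [mul_div_assoc, mul_div_assoc] at this
    rw [this]
    congr 3
    push_cast
    rw [show Mc M * ((1 + I) * z) * ((1 - I) * z) = (1 - I ^ 2) * (Mc M * z ^ 2) by ring, I_sq]
    ring
  ellip p q τ z hτ := by
    have := h.ellip p p q q τ ((1 + I) * z) ((1 - I) * z) hτ
    rw [show (1 + I) * z + ((p : ℂ) + p * I) * τ + ((q : ℂ) + q * I) =
        (1 + I) * (z + p * τ + q) by ring,
      show (1 - I) * z + ((p : ℂ) - p * I) * τ + ((q : ℂ) - q * I) =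
        (1 - I) * (z + p * τ + q) by ring] at this
    rw [this]
    congr 2
    push_cast
    linear_combination 2 * (p : ℂ) * z * I_sq
  fourier := by
    obtain ⟨c, hc, hs⟩ := h.fourier
    have hfin : ∀ (n : ℕ) (r : ℤ), Summable fun b : ℤ => c n (r + b) b := by
      intro n r
      apply summable_of_hasFiniteSupport
      refine (Set.finite_Icc (-(4 * n : ℤ)) (4 * n)).subset ?_
      intro b hb
      have h1 : ¬ (4 * (n : ℤ) * (1 : ℕ) < (r + b) ^ 2 + b ^ 2) := fun h => hb (hc _ _ _ h)
      push_cast at h1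
      have h2 : b ^ 2 ≤ 4 * n := by nlinarith [sq_nonneg (r + b)]
      constructor <;> nlinarith
    refine ⟨fun n r => ∑' b : ℤ, c n (r + b) b, fun n r hr => ?_, fun τ z hτ => ?_⟩
    · have : ∀ b : ℤ, c n (r + b) b = 0 := fun b => hc _ _ _ (by
        push_cast at hr ⊢; nlinarith [sq_nonneg (r + 2 * b)])
      simp [this]
    · let e : (ℕ × ℤ) × ℤ ≃ ℕ × ℤ × ℤ :=
        { toFun := fun x => (x.1.1, x.1.2 + x.2, x.2)
          invFun := fun y => ((y.1, y.2.1 - y.2.2), y.2.2)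
          left_inv := fun x => by simp
          right_inv := fun y => by simp }
      have h1 := hs τ ((1 + I) * z) ((1 - I) * z) hτ
      rw [← e.hasSum_iff] at h1
      refine h1.prod_fiberwise (g := fun p : ℕ × ℤ => (∑' b : ℤ, c p.1 (p.2 + b) b) *
        eC ((p.1 : ℂ) * τ + (p.2 : ℂ) * z)) fun p => ?_
      have h2 := (hfin p.1 p.2).hasSum.mul_right (eC ((p.1 : ℂ) * τ + (p.2 : ℂ) * z))
      refine HasSum_of_eq h2 fun b => ?_
      simp only [e, Equiv.coe_fn_mk, Function.comp]
      congr 2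
      push_cast
      linear_combination ((b : ℂ) * z) * I_sq

/-! ### Injectivity -/

def zz1 (u v : ℂ) : ℂ := ((1 - I) * u + (1 + I) * v) / 2
def zz2 (u v : ℂ) : ℂ := ((1 + I) * u + (1 - I) * v) / 2

lemma inj_core {τ : ℂ} (hτ : UHP τ) (F : ℂ → ℂ → ℂ) (hd : ∀ v, Differentiable ℂ (fun u => F u v))
    (hE : ∀ (p q a b : ℤ) (u v : ℂ), F (u + (p - q) * τ + (a - b)) (v + (p + q) * τ + (a + b)) =
      eC (-(((p : ℂ) ^ 2 + (q : ℂ) ^ 2) * τ + (p - q) * u + (p + q) * v)) * F u v)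
    (h0 : ∀ v, F 0 v = 0) (hsym : ∀ u v, F (-v) u = F u v) (u v : ℂ) : F u v = 0 := by
  have hD : ∀ v, DH τ (fun u => F u v) := fun v =>
    { diff := hd v
      two := fun u => by
        have := hE 0 0 1 (-1) u v
        norm_num [eC_zero] at this
        exact this
      tau := fun u => by
        have := hE 1 (-1) 0 0 u v
        norm_num [eC_zero] at this
        rw [this]; congr 2; ring }
  have z1 : ∀ v, F 1 v = 0 := fun v => by
    have := hE 0 0 1 0 0 (v - 1)
    rw [h0] at this
    norm_num at this
    exact this
  have z2 : ∀ v, F τ v = 0 := fun v => by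
    have := hE 1 0 0 0 0 (v - τ)
    rw [h0] at this
    norm_num at this
    exact this
  have z3 : ∀ v, F (τ + 1) v = 0 := fun v => by
    have := hE 1 0 1 0 0 (v - τ - 1)
    rw [h0] at this
    norm_num at this
    rwa [show v - τ - 1 + τ + 1 = v by ring] at this
  have hP : ∀ v s t, PJ τ s t (fun u => F u v) 0 = 0 := by
    intro v s t
    simp [PJ, h0, z1, z2, z3]
  have h3 : ∀ u v, F u v = PJ τ (-1) (-1) (fun u => F u v) u := by
    intro u v
    have a := PJ_sum τ (fun u => F u v) u
    have b0 := PJ_th0 hτ (hD v) u 0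
    have b1 := PJ_th1 hτ (hD v) u 0
    have b2 := PJ_th2 hτ (hD v) u 0
    rw [hP, zero_mul] at b0 b1 b2
    rw [(mul_eq_zero.mp b0).resolve_right (th0_ne hτ),
      (mul_eq_zero.mp b1).resolve_right (th1_ne hτ),
      (mul_eq_zero.mp b2).resolve_right (th2_ne hτ)] at a
    simpa using a
  have h4 : ∀ u w v, F u v * th3 τ w = F w v * th3 τ u := by
    intro u w v
    rw [h3 u v, h3 w v]
    exact PJ_th3 hτ (hD v) u w
  have hn := th3_ne hτ
  generalize -(τ / 2 + 1 / 2) = w at hn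
  have h5 : F w w = 0 := by
    have := h4 (-w) w w
    rw [hsym, th3_neg] at this
    have : F w w * th3 τ w = 0 := by linear_combination this / 2
    exact (mul_eq_zero.mp this).resolve_right hn
  have h6 : ∀ u, F w u = 0 := by
    intro u
    have a := h4 (-w) w u
    rw [hsym u w, th3_neg] at a
    have b := h4 u w w
    rw [h5, zero_mul] at b
    rw [b] at a
    have : F w u * th3 τ w = 0 := by linear_combination a
    exact (mul_eq_zero.mp this).resolve_right hn
  have := h4 u w v
  rw [h6, zero_mul] at this
  exact (mul_eq_zero.mp this).resolve_right hn

lemma HJF_uv {k : ℕ} {φ : ℂ → ℂ → ℂ → ℂ} (h : IsHJF k 1 φ) {τ : ℂ} (hτ : UHP τ)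
    (p q a b : ℤ) (u v : ℂ) :
    φ τ (zz1 (u + (p - q) * τ + (a - b)) (v + (p + q) * τ + (a + b)))
      (zz2 (u + (p - q) * τ + (a - b)) (v + (p + q) * τ + (a + b))) =
    eC (-(((p : ℂ) ^ 2 + (q : ℂ) ^ 2) * τ + (p - q) * u + (p + q) * v)) *
      φ τ (zz1 u v) (zz2 u v) := by
  have := h.ellip p q a b τ (zz1 u v) (zz2 u v) hτ
  convert this using 2
  · simp only [zz1]; ring
  · simp only [zz2]; ring
  · congr 1
    simp only [zz1, zz2]; push_cast
    linear_combination (q * u - q * v) * I_sq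

lemma HJF_sym {k : ℕ} (hk4 : k % 4 = 0) {φ : ℂ → ℂ → ℂ → ℂ} (h : IsHJF k 1 φ) {τ : ℂ} (hτ : UHP τ)
    (u v : ℂ) : φ τ (zz1 (-v) u) (zz2 (-v) u) = φ τ (zz1 u v) (zz2 u v) := by
  have := h.transf I (by simp) 1 τ (zz1 u v) (zz2 u v) hτ
  have hI : I ^ k = 1 := by
    obtain ⟨j, rfl⟩ := Nat.dvd_of_mod_eq_zero hk4
    rw [pow_mul, I_pow_four, one_pow]
  simp [Ma, Mb, Mc, Md, eC_zero, hI] at this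
  rw [← this]
  congr 1
  · simp only [zz1]; linear_combination (u - v) / 2 * I_sq
  · simp only [zz2]; linear_combination (u - v) / 2 * I_sq

lemma restr_inj (k : ℕ) (hk4 : k % 4 = 0) (φ φ' : ℂ → ℂ → ℂ → ℂ) (h : IsHJF k 1 φ)
    (h' : IsHJF k 1 φ')
    (heq : ∀ τ z : ℂ, UHP τ → φ τ ((1 + Complex.I) * z) ((1 - Complex.I) * z)
          = φ' τ ((1 + Complex.I) * z) ((1 - Complex.I) * z)) (τ z₁ z₂ : ℂ) (hτ : UHP τ) :
    φ τ z₁ z₂ = φ' τ z₁ z₂ := by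
  have hd : ∀ {φ : ℂ → ℂ → ℂ → ℂ}, IsHJF k 1 φ → ∀ v,
      Differentiable ℂ (fun u => φ τ (zz1 u v) (zz2 u v)) := by
    intro φ h v
    have hm : Differentiable ℂ (fun u : ℂ => (τ, zz1 u v, zz2 u v)) := by
      unfold zz1 zz2; fun_prop
    have := h.holo.comp (s := Set.univ) hm.differentiableOn (fun p hp => hτ)
    exact differentiableOn_univ.mp this
  have key := inj_core hτ (fun u v => φ τ (zz1 u v) (zz2 u v) - φ' τ (zz1 u v) (zz2 u v))
    (fun v => (hd h v).sub (hd h' v))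
    (fun p q a b u v => by
      simp only [HJF_uv h hτ, HJF_uv h' hτ]; ring)
    (fun v => by
      have := heq τ (v / 2) hτ
      rw [show (1 + I) * (v / 2) = zz1 0 v by simp only [zz1]; ring,
        show (1 - I) * (v / 2) = zz2 0 v by simp only [zz2]; ring] at this
      simp only [this, sub_self])
    (fun u v => by simp only [HJF_sym hk4 h hτ, HJF_sym hk4 h' hτ])
    (((1 + I) * z₁ + (1 - I) * z₂) / 2) (((1 - I) * z₁ + (1 + I) * z₂) / 2)
  rw [show zz1 (((1 + I) * z₁ + (1 - I) * z₂) / 2) (((1 - I) * z₁ + (1 + I) * z₂) / 2) = z₁ by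
      simp only [zz1]; linear_combination (z₂ - z₁) / 2 * I_sq,
    show zz2 (((1 + I) * z₁ + (1 - I) * z₂) / 2) (((1 - I) * z₁ + (1 + I) * z₂) / 2) = z₂ by
      simp only [zz2]; linear_combination (z₁ - z₂) / 2 * I_sq] at key
  exact sub_eq_zero.mp key

/-! ### Surjectivity: construction of the lift -/

def fJ (ψ : ℂ → ℂ → ℂ) (τ v : ℂ) : ℂ := ψ τ (v / 2)

def AA (ψ : ℂ → ℂ → ℂ) (s t τ : ℂ) : ℂ := PJ τ s t (fJ ψ τ) 0

lemma AA_eq (ψ : ℂ → ℂ → ℂ) (s t τ : ℂ) : AA ψ s t τ =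
    (ψ τ 0 + s * ψ τ (1 / 2) + t * (eC (τ / 2) * ψ τ (τ / 2))
      + s * t * (eC (τ / 2) * ψ τ ((τ + 1) / 2))) / 4 := by
  simp only [AA, PJ, fJ, zero_add, add_zero, zero_div]

def C0 (ψ : ℂ → ℂ → ℂ) (τ : ℂ) : ℂ := AA ψ 1 1 τ / th0 τ 0 ^ 2
def C1 (ψ : ℂ → ℂ → ℂ) (τ : ℂ) : ℂ := AA ψ 1 (-1) τ / th1 τ 0 ^ 2
def C2 (ψ : ℂ → ℂ → ℂ) (τ : ℂ) : ℂ := AA ψ (-1) 1 τ / th2 τ 0 ^ 2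

def uu (z₁ z₂ : ℂ) : ℂ := ((1 + I) * z₁ + (1 - I) * z₂) / 2
def vv (z₁ z₂ : ℂ) : ℂ := ((1 - I) * z₁ + (1 + I) * z₂) / 2

def Phi (ψ : ℂ → ℂ → ℂ) (τ z₁ z₂ : ℂ) : ℂ :=
  C0 ψ τ * (th0 τ (uu z₁ z₂) * th0 τ (vv z₁ z₂)) + C1 ψ τ * (th1 τ (uu z₁ z₂) * th1 τ (vv z₁ z₂))
    + C2 ψ τ * (th2 τ (uu z₁ z₂) * th2 τ (vv z₁ z₂))

section
variable {k : ℕ} {ψ : ℂ → ℂ → ℂ}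

lemma JF_S (h : IsJF k 2 ψ) {τ : ℂ} (hτ : UHP τ) (z : ℂ) :
    ψ (-1 / τ) (z / τ) = τ ^ k * eC (2 * z ^ 2 / τ) * ψ τ z := by
  have := h.transf ModularGroup.S τ z hτ
  simpa [Ma, Mb, Mc, Md, ModularGroup.S] using this

lemma JF_T (h : IsJF k 2 ψ) {τ : ℂ} (hτ : UHP τ) (z : ℂ) :
    ψ (τ + 1) z = ψ τ z := by
  have := h.transf ModularGroup.T τ z hτ
  simpa [Ma, Mb, Mc, Md, ModularGroup.T, eC_zero] using this

lemma JF_neg (hk : Even k) (h : IsJF k 2 ψ) {τ : ℂ} (hτ : UHP τ) (z : ℂ) :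
    ψ τ (-z) = ψ τ z := by
  have := h.transf (-1) τ z hτ
  simpa [Ma, Mb, Mc, Md, eC_zero, hk.neg_pow, div_neg] using this

lemma JF_one (h : IsJF k 2 ψ) {τ : ℂ} (hτ : UHP τ) (z : ℂ) : ψ τ (z + 1) = ψ τ z := by
  have := h.ellip 0 1 τ z hτ
  simpa [eC_zero] using this

lemma JF_DH (h : IsJF k 2 ψ) {τ : ℂ} (hτ : UHP τ) : DH τ (fJ ψ τ) where
  diff := by
    have hm : Differentiable ℂ (fun u : ℂ => (τ, u / 2)) := by fun_prop
    have := h.holo.comp (s := Set.univ) hm.differentiableOn (fun p hp => hτ)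
    exact differentiableOn_univ.mp this
  two v := by
    simp only [fJ]; rw [show (v + 2) / 2 = v / 2 + 1 by ring, JF_one h hτ]
  tau v := by
    have := h.ellip 1 0 τ (v / 2) hτ
    simp only [fJ]; rw [show (v + 2 * τ) / 2 = v / 2 + (1 : ℤ) * τ + (0 : ℤ) by push_cast; ring,
      this]
    congr 2; push_cast; ring

lemma AA_S (h : IsJF k 2 ψ) {τ : ℂ} (hτ : UHP τ) (s t : ℂ) :
    AA ψ s t (-1 / τ) = τ ^ k * AA ψ t s τ := by
  have h0 : τ ≠ 0 := by rintro rfl; simp [UHP] at hτ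
  have a := JF_S h hτ 0
  have b := JF_S h hτ (τ / 2)
  have c := JF_S h hτ (-1 / 2)
  have d := JF_S h hτ ((τ - 1) / 2)
  rw [show 2 * 0 ^ 2 / τ = 0 by simp, eC_zero, zero_div] at a
  rw [show τ / 2 / τ = 1 / 2 by field_simp, show 2 * (τ / 2) ^ 2 / τ = τ / 2 by field_simp] at b
  rw [show -1 / 2 / τ = -1 / τ / 2 by field_simp, ← JF_one h hτ (-1 / 2),
    show (-1 : ℂ) / 2 + 1 = 1 / 2 by norm_num] at c
  rw [show (τ - 1) / 2 / τ = (-1 / τ + 1) / 2 by field_simp; ring, ← JF_one h hτ ((τ - 1) / 2),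
    show (τ - 1) / 2 + 1 = (τ + 1) / 2 by ring] at d
  have e1 : eC (-1 / τ / 2) * eC (2 * (-1 / 2) ^ 2 / τ) = 1 := by
    rw [← eC_add, show -1 / τ / 2 + 2 * (-1 / 2) ^ 2 / τ = 0 by field_simp; ring, eC_zero]
  have e2 : eC (-1 / τ / 2) * eC (2 * ((τ - 1) / 2) ^ 2 / τ) = eC (τ / 2) := by
    rw [← eC_add]
    exact eC_eq_int (-1) (by push_cast; field_simp; ring)
  rw [AA_eq, AA_eq, a, b, c, d]
  linear_combination (t * τ ^ k * ψ τ (1 / 2) / 4) * e1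
    + (s * t * τ ^ k * ψ τ ((τ + 1) / 2) / 4) * e2

lemma AA_T (h : IsJF k 2 ψ) {τ : ℂ} (hτ : UHP τ) (s t : ℂ) (hs : s * s = 1) :
    AA ψ s t (τ + 1) = AA ψ s (- s * t) τ := by
  have e : eC ((τ + 1) / 2) = - eC (τ / 2) := eC_eq_half 0 (by push_cast; ring)
  rw [AA_eq, AA_eq, JF_T h hτ, JF_T h hτ, JF_T h hτ, JF_T h hτ, e,
    show (τ + 1 + 1) / 2 = τ / 2 + 1 by ring, JF_one h hτ]
  linear_combination (t * (eC (τ / 2) * ψ τ ((τ + 1) / 2)) / 4) * hs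

lemma C0_T (h : IsJF k 2 ψ) {τ : ℂ} (hτ : UHP τ) : C0 ψ (τ + 1) = C1 ψ τ := by
  rw [C0, C1, AA_T h hτ _ _ (by simp), th0_T]; norm_num
lemma C1_T (h : IsJF k 2 ψ) {τ : ℂ} (hτ : UHP τ) : C1 ψ (τ + 1) = C0 ψ τ := by
  rw [C0, C1, AA_T h hτ _ _ (by simp), th1_T]; norm_num
lemma C2_T (h : IsJF k 2 ψ) {τ : ℂ} (hτ : UHP τ) : eC (1 / 8) ^ 2 * C2 ψ (τ + 1) = C2 ψ τ := by
  rw [C2, C2, AA_T h hτ _ _ (by simp), th2_T]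
  have := eC_ne_zero (1 / 8)
  have := th2_ne hτ
  norm_num
  field_simp

def rt (τ : ℂ) : ℂ := (-I * τ) ^ (1 / 2 : ℂ)

lemma rt_ne {τ : ℂ} (hτ : UHP τ) : rt τ ≠ 0 := by
  have h0 : τ ≠ 0 := by rintro rfl; simp [UHP] at hτ
  rw [rt, Ne, Complex.cpow_eq_zero_iff]; simp [h0]

lemma th_S0 {τ : ℂ} (hτ : UHP τ) : th0 (-1 / τ) 0 = rt τ * th0 τ 0 ∧
    th1 (-1 / τ) 0 = rt τ * th2 τ 0 ∧ th2 (-1 / τ) 0 = rt τ * th1 τ 0 := by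
  have a := th0_S hτ 0
  have b := th1_S hτ 0
  have c := th2_S hτ 0
  simp only [zero_div, ne_eq, OfNat.ofNat_ne_zero, not_false_eq_true, zero_pow, eC_zero,
    mul_one] at a b c
  exact ⟨a, b, c⟩

lemma C0_S (h : IsJF k 2 ψ) {τ : ℂ} (hτ : UHP τ) :
    rt τ ^ 2 * C0 ψ (-1 / τ) = τ ^ k * C0 ψ τ := by
  rw [C0, C0, AA_S h hτ, (th_S0 hτ).1]
  have := rt_ne hτ
  have := th0_ne hτ
  field_simp
lemma C1_S (h : IsJF k 2 ψ) {τ : ℂ} (hτ : UHP τ) :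
    rt τ ^ 2 * C1 ψ (-1 / τ) = τ ^ k * C2 ψ τ := by
  rw [C1, C2, AA_S h hτ, (th_S0 hτ).2.1]
  have := rt_ne hτ
  have := th2_ne hτ
  field_simp
lemma C2_S (h : IsJF k 2 ψ) {τ : ℂ} (hτ : UHP τ) :
    rt τ ^ 2 * C2 ψ (-1 / τ) = τ ^ k * C1 ψ τ := by
  rw [C1, C2, AA_S h hτ, (th_S0 hτ).2.2]
  have := rt_ne hτ
  have := th1_ne hτ
  field_simp

lemma uu_sq (z₁ z₂ : ℂ) : uu z₁ z₂ ^ 2 + vv z₁ z₂ ^ 2 = 2 * (z₁ * z₂) := by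
  simp only [uu, vv]; linear_combination (z₁ - z₂) ^ 2 / 2 * I_sq

lemma Phi_S (h : IsJF k 2 ψ) {τ : ℂ} (hτ : UHP τ) (z₁ z₂ : ℂ) :
    Phi ψ (-1 / τ) (z₁ / τ) (z₂ / τ) = τ ^ k * eC (z₁ * z₂ / τ) * Phi ψ τ z₁ z₂ := by
  have h0 : τ ≠ 0 := by rintro rfl; simp [UHP] at hτ
  have e : eC (z₁ * z₂ / τ) = eC (uu z₁ z₂ ^ 2 / (2 * τ)) * eC (vv z₁ z₂ ^ 2 / (2 * τ)) := by
    rw [← eC_add, ← add_div, uu_sq]; congr 1; field_simp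
  have e1 : uu (z₁ / τ) (z₂ / τ) = uu z₁ z₂ / τ := by simp only [uu]; field_simp
  have e2 : vv (z₁ / τ) (z₂ / τ) = vv z₁ z₂ / τ := by simp only [vv]; field_simp
  simp only [Phi]
  rw [e1, e2, th0_S hτ, th1_S hτ, th2_S hτ, th0_S hτ, th1_S hτ, th2_S hτ, e]
  have c0 := C0_S h hτ
  have c1 := C1_S h hτ
  have c2 := C2_S h hτ
  unfold rt at c0 c1 c2
  generalize eC (uu z₁ z₂ ^ 2 / (2 * τ)) = A at *
  generalize eC (vv z₁ z₂ ^ 2 / (2 * τ)) = B at *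
  linear_combination A * B * (th0 τ (uu z₁ z₂) * th0 τ (vv z₁ z₂) * c0
    + th2 τ (uu z₁ z₂) * th2 τ (vv z₁ z₂) * c1 + th1 τ (uu z₁ z₂) * th1 τ (vv z₁ z₂) * c2)

lemma Phi_T (h : IsJF k 2 ψ) {τ : ℂ} (hτ : UHP τ) (z₁ z₂ : ℂ) :
    Phi ψ (τ + 1) z₁ z₂ = Phi ψ τ z₁ z₂ := by
  simp only [Phi]
  rw [th0_T, th1_T, th2_T, th0_T, th1_T, th2_T, C0_T h hτ, C1_T h hτ, ← C2_T h hτ]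
  ring

lemma Phi_I (τ z₁ z₂ : ℂ) : Phi ψ τ (I * z₁) (-I * z₂) = Phi ψ τ z₁ z₂ := by
  have e1 : uu (I * z₁) (-I * z₂) = - vv z₁ z₂ := by
    simp only [uu, vv]; linear_combination (z₁ + z₂) / 2 * I_sq
  have e2 : vv (I * z₁) (-I * z₂) = uu z₁ z₂ := by
    simp only [uu, vv]; linear_combination -(z₁ + z₂) / 2 * I_sq
  simp only [Phi]
  rw [e1, e2, th0_neg, th1_neg, th2_neg]; ring

lemma Phi_eps (τ z₁ z₂ : ℂ) (ε : ℂ) (hε : ε ∈ ({1, -1, Complex.I, -Complex.I} : Set ℂ)) :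
    Phi ψ τ (ε * z₁) ((starRingEnd ℂ) ε * z₂) = Phi ψ τ z₁ z₂ := by
  have h2 : ∀ z₁ z₂, Phi ψ τ (-z₁) (-z₂) = Phi ψ τ z₁ z₂ := by
    intro z₁ z₂
    rw [← Phi_I τ z₁ z₂, ← Phi_I τ (I * z₁)]
    congr 1
    · linear_combination (-z₁) * I_sq
    · linear_combination (-z₂) * I_sq
  rcases hε with rfl | rfl | rfl | rfl
  · simp
  · simpa using h2 z₁ z₂
  · simpa using Phi_I τ z₁ z₂
  · have := Phi_I (ψ := ψ) τ z₁ z₂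
    rw [← h2] at this
    simpa using this

lemma QP.ell {τ s t : ℂ} {G : ℂ → ℂ} (h : QP τ s t G) (hs : s * s = 1) (ht : t * t = 1)
    (p q a b : ℤ) (u v : ℂ) :
    G (u + (p - q) * τ + (a - b)) * G (v + (p + q) * τ + (a + b)) =
      eC (-(((p : ℂ) ^ 2 + (q : ℂ) ^ 2) * τ + (p - q) * u + (p + q) * v)) * (G u * G v) := by
  have hs0 : s ≠ 0 := by rintro rfl; simp at hs
  have ht0 : t ≠ 0 := by rintro rfl; simp at ht
  have h1 := h.shift hs ht (p - q) (a - b) u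
  have h2 := h.shift hs ht (p + q) (a + b) v
  push_cast at h1 h2
  rw [h1, h2, show -(((p : ℂ) ^ 2 + (q : ℂ) ^ 2) * τ + (p - q) * u + (p + q) * v) =
    -(((p : ℂ) - q) ^ 2 * τ / 2 + (p - q) * u) + -(((p : ℂ) + q) ^ 2 * τ / 2 + (p + q) * v) by ring,
    eC_add]
  have k1 : s ^ (a - b) * s ^ (a + b) = 1 := by
    rw [← zpow_add₀ hs0, show a - b + (a + b) = a + a by ring, zpow_add₀ hs0, ← mul_zpow, hs,
      one_zpow]
  have k2 : t ^ (p - q) * t ^ (p + q) = 1 := by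
    rw [← zpow_add₀ ht0, show p - q + (p + q) = p + p by ring, zpow_add₀ ht0, ← mul_zpow, ht,
      one_zpow]
  generalize s ^ (a - b) = x1 at *
  generalize s ^ (a + b) = x2 at *
  generalize t ^ (p - q) = x3 at *
  generalize t ^ (p + q) = x4 at *
  generalize eC (-(((p : ℂ) - q) ^ 2 * τ / 2 + (p - q) * u)) = A
  generalize eC (-(((p : ℂ) + q) ^ 2 * τ / 2 + (p + q) * v)) = B
  linear_combination A * B * G u * G v * (x3 * x4 * k1 + k2)

lemma Phi_ell (τ : ℂ) (p q a b : ℤ) (z₁ z₂ : ℂ) :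
    Phi ψ τ (z₁ + ((p : ℂ) + (q : ℂ) * Complex.I) * τ + ((a : ℂ) + (b : ℂ) * Complex.I))
          (z₂ + ((p : ℂ) - (q : ℂ) * Complex.I) * τ + ((a : ℂ) - (b : ℂ) * Complex.I))
      = eC (-((1 : ℕ) : ℂ) * (((p : ℂ) ^ 2 + (q : ℂ) ^ 2) * τ
          + ((p : ℂ) - (q : ℂ) * Complex.I) * z₁
          + ((p : ℂ) + (q : ℂ) * Complex.I) * z₂)) * Phi ψ τ z₁ z₂ := by
  have e1 : uu (z₁ + ((p : ℂ) + (q : ℂ) * Complex.I) * τ + ((a : ℂ) + (b : ℂ) * Complex.I))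
          (z₂ + ((p : ℂ) - (q : ℂ) * Complex.I) * τ + ((a : ℂ) - (b : ℂ) * Complex.I))
      = uu z₁ z₂ + (p - q) * τ + (a - b) := by
    simp only [uu]; linear_combination (q * τ + b) * I_sq
  have e2 : vv (z₁ + ((p : ℂ) + (q : ℂ) * Complex.I) * τ + ((a : ℂ) + (b : ℂ) * Complex.I))
          (z₂ + ((p : ℂ) - (q : ℂ) * Complex.I) * τ + ((a : ℂ) - (b : ℂ) * Complex.I))
      = vv z₁ z₂ + (p + q) * τ + (a + b) := by
    simp only [vv]; linear_combination -(q * τ + b) * I_sq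
  have e3 : -((1 : ℕ) : ℂ) * (((p : ℂ) ^ 2 + (q : ℂ) ^ 2) * τ
          + ((p : ℂ) - (q : ℂ) * Complex.I) * z₁
          + ((p : ℂ) + (q : ℂ) * Complex.I) * z₂) =
      -(((p : ℂ) ^ 2 + (q : ℂ) ^ 2) * τ + (p - q) * uu z₁ z₂ + (p + q) * vv z₁ z₂) := by
    simp only [uu, vv]; push_cast; ring
  simp only [Phi]
  rw [e1, e2, e3, (qp_th0 τ).ell (by simp) (by simp), (qp_th1 τ).ell (by simp) (by simp),
    (qp_th2 τ).ell (by simp) (by simp)]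
  ring

lemma Phi_restr (hk : Even k) (h : IsJF k 2 ψ) {τ : ℂ} (hτ : UHP τ) (z : ℂ) :
    Phi ψ τ ((1 + I) * z) ((1 - I) * z) = ψ τ z := by
  have e1 : uu ((1 + I) * z) ((1 - I) * z) = 0 := by
    simp only [uu]; linear_combination z * I_sq
  have e2 : vv ((1 + I) * z) ((1 - I) * z) = 2 * z := by
    simp only [vv]; linear_combination -z * I_sq
  have := decomp_even hτ (JF_DH h hτ) (fun v => by
    simp only [fJ]; rw [neg_div, JF_neg hk h hτ]) (2 * z)
  simp only [fJ] at this
  rw [mul_div_cancel_left₀ z two_ne_zero] at this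
  rw [this]
  simp only [Phi, C0, C1, C2, e1, e2, AA]
  have n0 := th0_ne hτ
  have n1 := th1_ne hτ
  have n2 := th2_ne hτ
  have h0 : ∀ s t, PJ τ s t (fJ ψ τ) 0 = PJ τ s t (fun v => ψ τ (v / 2)) 0 := fun _ _ => rfl
  simp only [h0]
  field_simp
end

/-! ### The full modular transformation law -/

section
variable {k : ℕ} {ψ : ℂ → ℂ → ℂ}

lemma M_det (M : Matrix.SpecialLinearGroup (Fin 2) ℤ) : Ma M * Md M - Mb M * Mc M = 1 := by
  have := M.2
  rw [Matrix.det_fin_two] at this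
  simp only [Ma, Mb, Mc, Md]
  exact_mod_cast this

lemma M_j_ne (M : Matrix.SpecialLinearGroup (Fin 2) ℤ) {τ : ℂ} (hτ : UHP τ) :
    Mc M * τ + Md M ≠ 0 := by
  intro h
  have h1 := congrArg Complex.im h
  simp [Mc, Md] at h1
  have h2 : M.1 1 0 = 0 := by
    rcases h1 with h1 | h1
    · exact_mod_cast h1
    · exact absurd h1 hτ.ne'
  have h3 : Mc M = 0 := by simp [Mc, h2]
  have h4 := M_det M
  rw [h3] at h h4
  have h5 : Md M = 0 := by simpa using h
  rw [h5] at h4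
  simp at h4

lemma M_UHP (M : Matrix.SpecialLinearGroup (Fin 2) ℤ) {τ : ℂ} (hτ : UHP τ) :
    UHP ((Ma M * τ + Mb M) / (Mc M * τ + Md M)) := by
  have h := UpperHalfPlane.coe_specialLinearGroup_apply M (⟨τ, hτ⟩ : UpperHalfPlane)
  have h2 := (M • (⟨τ, hτ⟩ : UpperHalfPlane)).2
  have h3 : ((M • (⟨τ, hτ⟩ : UpperHalfPlane) : UpperHalfPlane) : ℂ) =
      (Ma M * τ + Mb M) / (Mc M * τ + Md M) := by
    rw [h]; simp [Ma, Mb, Mc, Md]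
  unfold UHP
  rw [← h3]
  exact h2

lemma slash_mul (φ : ℂ → ℂ → ℂ → ℂ) (M N : Matrix.SpecialLinearGroup (Fin 2) ℤ) {τ : ℂ}
    (hτ : UHP τ) (z₁ z₂ : ℂ) :
    slashHJF k 1 φ (M * N) τ z₁ z₂ = slashHJF k 1 (slashHJF k 1 φ M) N τ z₁ z₂ := by
  have a1 : Ma (M * N) = Ma M * Ma N + Mb M * Mc N := by
    simp [Ma, Mb, Mc, Matrix.mul_apply, Fin.sum_univ_two]
  have a2 : Mb (M * N) = Ma M * Mb N + Mb M * Md N := by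
    simp [Ma, Mb, Md, Matrix.mul_apply, Fin.sum_univ_two]
  have a3 : Mc (M * N) = Mc M * Ma N + Md M * Mc N := by
    simp [Ma, Md, Mc, Matrix.mul_apply, Fin.sum_univ_two]
  have a4 : Md (M * N) = Mc M * Mb N + Md M * Md N := by
    simp [Md, Mb, Mc, Matrix.mul_apply, Fin.sum_univ_two]
  have hN := M_j_ne N hτ
  have hM := M_j_ne M (M_UHP N hτ)
  have hMN := M_j_ne (M * N) hτ
  have dN := M_det N
  set jN := Mc N * τ + Md N with hjN
  set σ := (Ma N * τ + Mb N) / jN with hσ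
  set jM := Mc M * σ + Md M with hjM
  have hσ' : σ * jN = Ma N * τ + Mb N := by rw [hσ]; field_simp
  have hj : Mc (M * N) * τ + Md (M * N) = jM * jN := by
    rw [a3, a4, hjM]; linear_combination (-Mc M) * hσ' + Md M * (-hjN)
  have hn : Ma (M * N) * τ + Mb (M * N) = (Ma M * σ + Mb M) * jN := by
    rw [a1, a2]; linear_combination (-Ma M) * hσ' + Mb M * (-hjN)
  have hk : Mc M + Mc N * (jM * jN) = Mc (M * N) * jN := by
    rw [a3, hjM]
    linear_combination Mc N * Mc M * hσ' - Mc M * dN - Mc M * Ma N * hjN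
  simp only [slashHJF]
  rw [hj, hn]
  simp only [← hjN, ← hσ, ← hjM]
  clear_value jM σ jN
  rw [mul_div_mul_right _ _ hN, show z₁ / (jM * jN) = z₁ / jN / jM by field_simp,
    show z₂ / (jM * jN) = z₂ / jN / jM by field_simp,
    show -((1 : ℕ) : ℂ) * Mc (M * N) * z₁ * z₂ / (jM * jN) =
      -((1 : ℕ) : ℂ) * Mc N * z₁ * z₂ / jN +
      -((1 : ℕ) : ℂ) * Mc M * (z₁ / jN) * (z₂ / jN) / jM by
        push_cast
        field_simp
        linear_combination z₁ * z₂ * hk, eC_add, mul_pow, mul_inv]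
  ring

lemma Phi_slash (h : IsJF k 2 ψ) (M : Matrix.SpecialLinearGroup (Fin 2) ℤ) :
    ∀ τ z₁ z₂ : ℂ, UHP τ → slashHJF k 1 (Phi ψ) M τ z₁ z₂ = Phi ψ τ z₁ z₂ := by
  have hM : M ∈ Subgroup.closure
      ({ModularGroup.S, ModularGroup.T} : Set (Matrix.SpecialLinearGroup (Fin 2) ℤ)) := by
    rw [_root_.SpecialLinearGroup.SL2Z_generators]; trivial
  have h1 : ∀ (φ : ℂ → ℂ → ℂ → ℂ) (τ z₁ z₂ : ℂ), slashHJF k 1 φ 1 τ z₁ z₂ = φ τ z₁ z₂ := by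
    intro φ τ z₁ z₂
    simp [slashHJF, Ma, Mb, Mc, Md, eC_zero]
  induction hM using Subgroup.closure_induction with
  | mem x hx =>
    intro τ z₁ z₂ hτ
    have h0 : τ ≠ 0 := by rintro rfl; simp [UHP] at hτ
    rcases hx with rfl | rfl
    · have := Phi_S h hτ z₁ z₂
      have e : eC (-(z₁ * z₂) / τ) * eC (z₁ * z₂ / τ) = 1 := by
        rw [← eC_add, neg_div, neg_add_cancel, eC_zero]
      simp only [slashHJF, Ma, Mb, Mc, Md, ModularGroup.S]
      simp
      rw [this]
      field_simp
      rw [neg_div] at e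
      linear_combination Phi ψ τ z₁ z₂ * e
    · have := Phi_T h hτ z₁ z₂
      simp only [slashHJF, Ma, Mb, Mc, Md, ModularGroup.T]
      simp [eC_zero, this]
  | one => intro τ z₁ z₂ _; exact h1 _ _ _ _
  | mul x y _ _ hx hy =>
    intro τ z₁ z₂ hτ
    rw [slash_mul _ _ _ hτ, ← hy τ z₁ z₂ hτ]
    simp only [slashHJF]
    congr 1
    exact hx _ _ _ (M_UHP y hτ)
  | inv x _ hx =>
    intro τ z₁ z₂ hτ
    rw [← h1 (Phi ψ) τ z₁ z₂, ← mul_inv_cancel x, slash_mul _ _ _ hτ]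
    conv_lhs => unfold slashHJF
    conv_rhs => unfold slashHJF
    congr 1
    exact (hx _ _ _ (M_UHP _ hτ)).symm

lemma Phi_transf (hk4 : k % 4 = 0) (h : IsJF k 2 ψ) (ε : ℂ)
    (hε : ε ∈ ({1, -1, Complex.I, -Complex.I} : Set ℂ))
    (M : Matrix.SpecialLinearGroup (Fin 2) ℤ) (τ z₁ z₂ : ℂ) (hτ : UHP τ) :
      Phi ψ ((Ma M * τ + Mb M) / (Mc M * τ + Md M))
        (ε * z₁ / (Mc M * τ + Md M))
        ((starRingEnd ℂ) ε * z₂ / (Mc M * τ + Md M))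
      = ε ^ k * (Mc M * τ + Md M) ^ k *
          eC (((1 : ℕ) : ℂ) * Mc M * z₁ * z₂ / (Mc M * τ + Md M)) * Phi ψ τ z₁ z₂ := by
  have h4 : ε ^ 4 = 1 := by
    rcases hε with rfl | rfl | rfl | rfl
    · norm_num
    · norm_num
    · exact I_pow_four
    · rw [Even.neg_pow (by decide), I_pow_four]
  have hεk : ε ^ k = 1 := by
    obtain ⟨j, rfl⟩ := Nat.dvd_of_mod_eq_zero hk4
    rw [pow_mul, h4, one_pow]
  have h5 : ε * (starRingEnd ℂ) ε = 1 := by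
    rcases hε with rfl | rfl | rfl | rfl <;> simp
  have := Phi_slash h M τ (ε * z₁) ((starRingEnd ℂ) ε * z₂) hτ
  rw [Phi_eps _ _ _ _ hε] at this
  rw [← this, slashHJF, hεk, show -((1 : ℕ) : ℂ) * Mc M * (ε * z₁) * ((starRingEnd ℂ) ε * z₂) =
    -(((1 : ℕ) : ℂ) * Mc M * z₁ * z₂) * (ε * (starRingEnd ℂ) ε) by ring, h5, mul_one]
  clear this
  have hj := M_j_ne M hτ
  have e : eC (((1 : ℕ) : ℂ) * Mc M * z₁ * z₂ / (Mc M * τ + Md M)) *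
      eC (-(((1 : ℕ) : ℂ) * Mc M * z₁ * z₂) / (Mc M * τ + Md M)) = 1 := by
    rw [← eC_add, neg_div, add_neg_cancel, eC_zero]
  have e2 : (Mc M * τ + Md M) ^ k * ((Mc M * τ + Md M) ^ k)⁻¹ = 1 :=
    mul_inv_cancel₀ (pow_ne_zero _ hj)
  generalize eC (((1 : ℕ) : ℂ) * Mc M * z₁ * z₂ / (Mc M * τ + Md M)) = A at *
  generalize eC (-(((1 : ℕ) : ℂ) * Mc M * z₁ * z₂) / (Mc M * τ + Md M)) = B at *
  generalize ((Mc M * τ + Md M) ^ k)⁻¹ = D at *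
  generalize (Mc M * τ + Md M) ^ k = E at *
  generalize Phi ψ _ _ _ = P at *
  linear_combination -P * (E * D * e + e2)

/-! ### Holomorphy -/

lemma isOpen_UHP : IsOpen {p : ℂ | UHP p} := isOpen_lt continuous_const Complex.continuous_im

lemma AA_diff (h : IsJF k 2 ψ) (s t : ℂ) {τ : ℂ} (hτ : UHP τ) : DifferentiableAt ℂ (AA ψ s t) τ := by
  have key : ∀ g : ℂ → ℂ, Differentiable ℂ g → DifferentiableAt ℂ (fun τ => ψ τ (g τ)) τ := by
    intro g hg
    have hm : Differentiable ℂ (fun u : ℂ => (u, g u)) := by fun_prop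
    have := h.holo.comp (s := {p : ℂ | UHP p}) hm.differentiableOn (fun p hp => hp)
    exact (this τ hτ).differentiableAt (isOpen_UHP.mem_nhds hτ)
  have e : AA ψ s t = fun τ => (ψ τ 0 + s * ψ τ (1 / 2) + t * (eC (τ / 2) * ψ τ (τ / 2))
      + s * t * (eC (τ / 2) * ψ τ ((τ + 1) / 2))) / 4 := funext fun τ => AA_eq ψ s t τ
  rw [e]
  have a := key (fun _ => 0) (by fun_prop)
  have b := key (fun _ => 1 / 2) (by fun_prop)
  have c := key (fun τ => τ / 2) (by fun_prop)
  have d := key (fun τ => (τ + 1) / 2) (by fun_prop)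
  have he : DifferentiableAt ℂ (fun τ : ℂ => eC (τ / 2)) τ := diffAt_eC (by fun_prop)
  exact (((a.add (b.const_mul s)).add ((he.mul c).const_mul t)).add
    ((he.mul d).const_mul (s * t))).div_const 4

lemma C0_diff (h : IsJF k 2 ψ) {τ : ℂ} (hτ : UHP τ) : DifferentiableAt ℂ (C0 ψ) τ :=
  (AA_diff h 1 1 hτ).div ((diff_th0 (g := fun z => z) (by fun_prop) (by fun_prop) hτ).pow 2)
    (pow_ne_zero _ (th0_ne hτ))
lemma C1_diff (h : IsJF k 2 ψ) {τ : ℂ} (hτ : UHP τ) : DifferentiableAt ℂ (C1 ψ) τ :=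
  (AA_diff h 1 (-1) hτ).div ((diff_th1 (g := fun z => z) (by fun_prop) (by fun_prop) hτ).pow 2)
    (pow_ne_zero _ (th1_ne hτ))
lemma C2_diff (h : IsJF k 2 ψ) {τ : ℂ} (hτ : UHP τ) : DifferentiableAt ℂ (C2 ψ) τ :=
  (AA_diff h (-1) 1 hτ).div ((diff_th2 (g := fun z => z) (by fun_prop) (by fun_prop) hτ).pow 2)
    (pow_ne_zero _ (th2_ne hτ))

lemma Phi_holo (h : IsJF k 2 ψ) :
    DifferentiableOn ℂ (fun p : ℂ × ℂ × ℂ => Phi ψ p.1 p.2.1 p.2.2) {p | UHP p.1} := by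
  intro p hp
  apply DifferentiableAt.differentiableWithinAt
  have h1 : DifferentiableAt ℂ (fun p : ℂ × ℂ × ℂ => p.1) p := by fun_prop
  have hu : DifferentiableAt ℂ (fun p : ℂ × ℂ × ℂ => uu p.2.1 p.2.2) p := by unfold uu; fun_prop
  have hv : DifferentiableAt ℂ (fun p : ℂ × ℂ × ℂ => vv p.2.1 p.2.2) p := by unfold vv; fun_prop
  have c0 : DifferentiableAt ℂ (fun p : ℂ × ℂ × ℂ => C0 ψ p.1) p :=
    DifferentiableAt.comp p (C0_diff h hp) h1
  have c1 : DifferentiableAt ℂ (fun p : ℂ × ℂ × ℂ => C1 ψ p.1) p :=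
    DifferentiableAt.comp p (C1_diff h hp) h1
  have c2 : DifferentiableAt ℂ (fun p : ℂ × ℂ × ℂ => C2 ψ p.1) p :=
    DifferentiableAt.comp p (C2_diff h hp) h1
  exact ((c0.mul ((diff_th0 h1 hu hp).mul (diff_th0 h1 hv hp))).add
    (c1.mul ((diff_th1 h1 hu hp).mul (diff_th1 h1 hv hp)))).add
    (c2.mul ((diff_th2 h1 hu hp).mul (diff_th2 h1 hv hp)))
end

/-! ### Fourier expansion of the lift -/

lemma ev_UHP : ∀ᶠ τ : ℂ in Linf, UHP τ :=
  Filter.tendsto_comap.eventually (Filter.eventually_gt_atTop 0)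

instance Linf_neBot : Filter.NeBot Linf := by
  apply Filter.comap_neBot
  intro t ht
  obtain ⟨a, ha⟩ := Filter.mem_atTop_sets.mp ht
  exact ⟨a * I, by simpa using ha a le_rfl⟩

open UpperHalfPlane in
lemma q_exp (g : ℂ → ℂ) (l : ℂ) (hd : ∀ τ, UHP τ → DifferentiableAt ℂ g τ)
    (hp : ∀ τ, UHP τ → g (τ + 1) = g τ) (hl : Filter.Tendsto g Linf (nhds l)) :
    ∃ d : ℕ → ℂ, d 0 = l ∧ ∀ τ, UHP τ → HasSum (fun n : ℕ => d n * eC (n * τ)) (g τ) := by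
  set f : ℍ → ℂ := fun z => g z with hf
  have h1 : Filter.Tendsto (fun z : ℍ => (z : ℂ)) atImInfty Linf := by
    rw [Filter.tendsto_comap_iff]; exact Filter.tendsto_comap
  have hb : IsBoundedAtImInfty f := (hl.comp h1).isBigO_one ℝ
  have hper : Function.Periodic (f ∘ ofComplex) ((1 : ℝ) : ℂ) := by
    intro x
    simp only [Function.comp, hf, ofReal_one]
    by_cases hx : 0 < x.im
    · rw [ofComplex_apply_of_im_pos hx, ofComplex_apply_of_im_pos (by simpa using hx)]
      exact hp x hx
    · rw [ofComplex_apply_of_im_nonpos (by simpa using hx),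
        ofComplex_apply_of_im_nonpos (by simpa using hx)]
  have hm := (UpperHalfPlane.mdifferentiable_iff (f := f)).mpr (by
      refine DifferentiableOn.congr (f := g) (fun z hz ↦ ?_) fun z hz ↦ ?_
      · exact (hd z hz).differentiableWithinAt
      · simp [hf, ofComplex_apply_of_im_pos hz])
  have key : ∀ τ, UHP τ → HasSum (fun n : ℕ => (qExpansion 1 f).coeff n * eC (n * τ)) (g τ) := by
    intro τ hτ
    have := UpperHalfPlane.hasSum_qExpansion one_pos hper hm hb ⟨τ, hτ⟩
    refine HasSum_of_eq this fun n => ?_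
    rw [smul_eq_mul]; congr 1
    rw [← eC_pow]; congr 1
    simp [eC, Function.Periodic.qParam]
  refine ⟨fun n => (qExpansion 1 f).coeff n, ?_, key⟩
  have L := lim_series (fun n : ℕ => (qExpansion 1 f).coeff n) (fun n => (n : ℝ))
    (fun n _ => by positivity) (by simpa using (key Complex.I (by simp [UHP])).summable)
  rw [tsum_eq_single 0 (by intro n hn; simp [hn])] at L
  simp only [Nat.cast_zero, if_true] at L
  refine tendsto_nhds_unique (L.congr' ?_) hl
  filter_upwards [ev_UHP] with τ hτ
  simpa using (key τ hτ).tsum_eq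

section
variable {k : ℕ} {ψ : ℂ → ℂ → ℂ}

lemma lim_J {c : ℕ → ℤ → ℂ} (hc : ∀ (n : ℕ) (r : ℤ), 4 * (n : ℤ) * (2 : ℕ) < r ^ 2 → c n r = 0)
    (hs : ∀ τ z : ℂ, UHP τ →
        HasSum (fun p : ℕ × ℤ => c p.1 p.2 * eC ((p.1 : ℂ) * τ + (p.2 : ℂ) * z)) (ψ τ z))
    (α : ℝ) (β : ℂ) (hE : ∀ (n : ℕ) (r : ℤ), r ^ 2 ≤ 8 * (n : ℤ) → 0 ≤ n + r * α + α) :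
    Filter.Tendsto (fun τ => eC (α * τ) * ψ τ (α * τ + β)) Linf
      (nhds (∑' p : ℕ × ℤ, if (p.1 + p.2 * α + α : ℝ) = 0 then c p.1 p.2 * eC (p.2 * β) else 0)) := by
  have key : ∀ τ, UHP τ → HasSum (fun p : ℕ × ℤ => c p.1 p.2 * eC (p.2 * β) *
      eC ((p.1 + p.2 * α + α : ℝ) * τ)) (eC (α * τ) * ψ τ (α * τ + β)) := by
    intro τ hτ
    refine HasSum_of_eq ((hs τ (α * τ + β) hτ).mul_left (eC (α * τ))) fun p => ?_
    rw [mul_assoc, ← eC_add, mul_left_comm, ← eC_add]; congr 2; push_cast; ring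
  have := lim_series (fun p : ℕ × ℤ => c p.1 p.2 * eC (p.2 * β)) (fun p => p.1 + p.2 * α + α)
    (fun p hp => hE p.1 p.2 (by
      by_contra hlt
      exact hp (by rw [hc p.1 p.2 (by push_cast; linarith), zero_mul])))
    (key I (by simp [UHP])).summable
  refine this.congr' ?_
  filter_upwards [ev_UHP] with τ hτ
  exact (key τ hτ).tsum_eq

lemma lim_AA (h : IsJF k 2 ψ) : ∃ a : ℂ, ∀ s t : ℂ,
    Filter.Tendsto (AA ψ s t) Linf (nhds ((1 + s) * a)) := by
  obtain ⟨c, hc, hs⟩ := h.fourier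
  have h0 : ∀ β : ℂ, Filter.Tendsto (fun τ => ψ τ β) Linf (nhds (c 0 0)) := by
    intro β
    have := lim_J hc hs 0 β (fun n r _ => by simp)
    simp only [ofReal_zero, zero_mul, eC_zero, one_mul, zero_add, mul_zero, add_zero] at this
    rw [tsum_eq_single (0, 0)] at this
    · simpa [eC_zero] using this
    · rintro ⟨n, r⟩ hne
      rw [ite_eq_right_iff]
      intro hn
      have hn : n = 0 := by exact_mod_cast hn
      subst hn
      have hr : r ≠ 0 := by rintro rfl; exact hne rfl
      rw [hc 0 r (by have : 0 < r ^ 2 := by positivity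
                     simpa using this), zero_mul]
  have h1 : ∀ β : ℂ, Filter.Tendsto (fun τ => eC (τ / 2) * ψ τ (τ / 2 + β)) Linf (nhds 0) := by
    intro β
    have := lim_J hc hs (1 / 2) β (fun n r hr => by
      have hr' : ((r : ℝ)) ^ 2 ≤ 8 * n := by exact_mod_cast hr
      nlinarith [sq_nonneg ((r : ℝ) + 2)])
    rw [show (∑' p : ℕ × ℤ, if (p.1 + p.2 * (1 / 2 : ℝ) + (1 / 2 : ℝ) : ℝ) = 0
      then c p.1 p.2 * eC (p.2 * β) else 0) = 0 from ?_] at this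
    · refine this.congr fun τ => ?_
      congr 2 <;> push_cast <;> ring
    · refine (tsum_congr (g := fun _ => (0 : ℂ)) fun p => ?_).trans tsum_zero
      rw [ite_eq_right_iff]
      intro hp
      have hp' : 2 * (p.1 : ℤ) + p.2 + 1 = 0 := by
        have : (2 * (p.1 : ℝ) + p.2 + 1) = 0 := by linarith
        exact_mod_cast this
      rw [hc p.1 p.2 ?_, zero_mul]
      by_contra hle
      push_cast at hle
      have : (p.2 + 2) ^ 2 ≤ 0 := by nlinarith
      have : p.2 + 2 = 0 := by nlinarith
      omega
  refine ⟨c 0 0 / 4, fun s t => ?_⟩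
  have := ((((h0 0).add ((h0 (1 / 2)).const_mul s)).add ((h1 0).const_mul t)).add
    ((h1 (1 / 2)).const_mul (s * t))).div_const 4
  rw [show (c 0 0 + s * c 0 0 + t * 0 + s * t * 0) / 4 = (1 + s) * (c 0 0 / 4) by ring] at this
  refine this.congr fun τ => ?_
  rw [AA_eq, add_zero, show (τ + 1) / 2 = τ / 2 + 1 / 2 by ring]

/-- theta components -/
lemma exp00 (h : IsJF k 2 ψ) : ∃ d : ℕ → ℂ, ∀ τ, UHP τ →
    HasSum (fun n : ℕ => d n * eC (n * τ)) (C0 ψ τ + C1 ψ τ) := by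
  obtain ⟨a, ha⟩ := lim_AA h
  have l := ((ha 1 1).div (lim_th0.pow 2) (by simp)).add ((ha 1 (-1)).div (lim_th1.pow 2) (by simp))
  obtain ⟨d, -, hd⟩ := q_exp (fun τ => C0 ψ τ + C1 ψ τ) _
    (fun τ hτ => (C0_diff h hτ).add (C1_diff h hτ))
    (fun τ hτ => by rw [C0_T h hτ, C1_T h hτ, add_comm]) l
  exact ⟨d, hd⟩

lemma sum_shift {g : ℂ} {d : ℕ → ℂ} {τ ρ : ℂ} (h0 : d 0 = 0)
    (h : HasSum (fun n : ℕ => d n * eC (n * τ)) (g * eC ((1 - ρ) * τ))) :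
    HasSum (fun n : ℕ => d (n + 1) * eC ((n + ρ) * τ)) g := by
  rw [← hasSum_nat_add_iff' 1] at h
  simp only [Finset.range_one, Finset.sum_singleton, h0, zero_mul, sub_zero] at h
  have := h.mul_right (eC (-((1 - ρ) * τ)))
  rw [mul_assoc, ← eC_add, add_neg_cancel, eC_zero, mul_one] at this
  refine HasSum_of_eq this fun n => ?_
  rw [mul_assoc, ← eC_add]; congr 2; push_cast; ring

lemma exp11 (h : IsJF k 2 ψ) : ∃ d : ℕ → ℂ, ∀ τ, UHP τ →
    HasSum (fun n : ℕ => d n * eC ((n + (1 / 2 : ℂ)) * τ)) (C0 ψ τ - C1 ψ τ) := by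
  obtain ⟨a, ha⟩ := lim_AA h
  have l := ((ha 1 1).div (lim_th0.pow 2) (by simp)).sub ((ha 1 (-1)).div (lim_th1.pow 2) (by simp))
  have e : Filter.Tendsto (fun τ : ℂ => eC ((1 - 1 / 2) * τ)) Linf (nhds 0) := by
    have := lim_series (fun _ : Unit => (1 : ℂ)) (fun _ => (1 / 2 : ℝ)) (by simp)
      Summable.of_finite
    simp only [tsum_fintype, Finset.univ_unique, Finset.sum_const, Finset.card_singleton,
      one_smul, one_mul] at this
    norm_num at this
    refine this.congr fun τ => ?_
    congr 1; ring
  have l2 := l.mul e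
  rw [mul_zero] at l2
  obtain ⟨d, d0, hd⟩ := q_exp (fun τ => (C0 ψ τ - C1 ψ τ) * eC ((1 - 1 / 2) * τ)) _
    (fun τ hτ => ((C0_diff h hτ).sub (C1_diff h hτ)).mul (diffAt_eC (by fun_prop)))
    (fun τ hτ => by
      rw [C0_T h hτ, C1_T h hτ, show eC ((1 - 1 / 2) * (τ + 1)) = - eC ((1 - 1 / 2) * τ) from
        eC_eq_half 0 (by push_cast; ring)]; ring) l2
  exact ⟨fun n => d (n + 1), fun τ hτ => sum_shift d0 (hd τ hτ)⟩

lemma exp10 (h : IsJF k 2 ψ) : ∃ d : ℕ → ℂ, ∀ τ, UHP τ →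
    HasSum (fun n : ℕ => d n * eC ((n + (3 / 4 : ℂ)) * τ)) (C2 ψ τ) := by
  obtain ⟨a, ha⟩ := lim_AA h
  have l := ((ha (-1) 1).div (lim_th2.pow 2) (by simp))
  have l2 : Filter.Tendsto (fun τ => C2 ψ τ * eC ((1 - 3 / 4) * τ)) Linf (nhds 0) := by
    have e0 : (1 + -1) * a / 2 ^ 2 = 0 := by ring
    rw [e0] at l
    refine l.congr fun τ => ?_
    simp only [C2, th2, Pi.div_apply]
    rw [mul_pow, eC_pow, zero_add, show ((2 : ℕ) : ℂ) * (τ / 8 + 0 / 2) = (1 - 3 / 4) * τ by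
      push_cast; ring]
    have := eC_ne_zero ((1 - 3 / 4) * τ)
    generalize eC ((1 - 3 / 4) * τ) = x at this ⊢
    rw [mul_comm x, ← div_div, div_mul_cancel₀ _ this]
  obtain ⟨d, d0, hd⟩ := q_exp (fun τ => C2 ψ τ * eC ((1 - 3 / 4) * τ)) _
    (fun τ hτ => (C2_diff h hτ).mul (diffAt_eC (by fun_prop)))
    (fun τ hτ => by
      rw [← C2_T h hτ, eC_pow, show (1 - 3 / 4) * (τ + 1) = (1 - 3 / 4) * τ + (2 : ℕ) * (1 / 8) by
        push_cast; ring, eC_add]; ring) l2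
  exact ⟨fun n => d (n + 1), fun τ hτ => sum_shift d0 (hd τ hτ)⟩

end

lemma hs_prod {ι κ : Type*} {f : ι → ℂ} {g : κ → ℂ} {a b : ℂ} (hf : HasSum f a) (hg : HasSum g b) :
    HasSum (fun p : ι × κ => f p.1 * g p.2) (a * b) :=
  hf.mul hg (summable_mul_of_summable_norm hf.summable.norm hg.summable.norm)

def FC (F : ℂ → ℂ → ℂ → ℂ) : Prop :=
  ∃ c : ℕ → ℤ → ℤ → ℂ,
      (∀ (n : ℕ) (a b : ℤ), 4 * (n : ℤ) * (1 : ℕ) < a ^ 2 + b ^ 2 → c n a b = 0) ∧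
      ∀ τ z₁ z₂ : ℂ, UHP τ →
        HasSum (fun p : ℕ × ℤ × ℤ => c p.1 p.2.1 p.2.2 *
          eC ((p.1 : ℂ) * τ + (((p.2.1 : ℂ) + (p.2.2 : ℂ) * Complex.I) / 2) * z₁
            + (((p.2.1 : ℂ) - (p.2.2 : ℂ) * Complex.I) / 2) * z₂)) (F τ z₁ z₂)

lemma FC.add {F G : ℂ → ℂ → ℂ → ℂ} (hF : FC F) (hG : FC G) :
    FC (fun τ z₁ z₂ => F τ z₁ z₂ + G τ z₁ z₂) := by
  obtain ⟨c, hc, hs⟩ := hF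
  obtain ⟨c', hc', hs'⟩ := hG
  refine ⟨fun n a b => c n a b + c' n a b, fun n a b h => by simp [hc n a b h, hc' n a b h],
    fun τ z₁ z₂ hτ => ?_⟩
  exact HasSum_of_eq ((hs τ z₁ z₂ hτ).add (hs' τ z₁ z₂ hτ)) fun p => add_mul _ _ _

lemma FC_mul (d : ℕ → ℂ) (ρ : ℝ) (hρ : 0 ≤ ρ) (H : ℂ → ℂ)
    (hH : ∀ τ, UHP τ → HasSum (fun n : ℕ => d n * eC ((n + (ρ : ℂ)) * τ)) (H τ))
    (w : ℤ × ℤ → ℂ) (e : ℤ × ℤ → ℤ × ℤ) (he : Function.Injective e)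
    (hK : ∀ p, w p ≠ 0 → ∃ K : ℕ, (K : ℝ) = ρ + (((e p).1 : ℝ) ^ 2 + ((e p).2 : ℝ) ^ 2) / 4)
    (T : ℂ → ℂ → ℂ → ℂ)
    (hT : ∀ τ z₁ z₂, UHP τ → HasSum (fun p => w p *
      eC ((((e p).1 : ℂ) ^ 2 + ((e p).2 : ℂ) ^ 2) / 4 * τ
        + ((((e p).1 : ℂ) + ((e p).2 : ℂ) * I) / 2) * z₁
        + ((((e p).1 : ℂ) - ((e p).2 : ℂ) * I) / 2) * z₂)) (T τ z₁ z₂)) :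
    FC (fun τ z₁ z₂ => H τ * T τ z₁ z₂) := by
  have hK' : ∀ p, ∃ K : ℕ, w p ≠ 0 →
      (K : ℝ) = ρ + (((e p).1 : ℝ) ^ 2 + ((e p).2 : ℝ) ^ 2) / 4 := by
    intro p
    by_cases h : w p = 0
    · exact ⟨0, fun h' => absurd h h'⟩
    · obtain ⟨K, hK⟩ := hK p h
      exact ⟨K, fun _ => hK⟩
  choose K hK using hK'
  let j : ℕ × (ℤ × ℤ) → ℕ × ℤ × ℤ := fun x => (x.1 + K x.2, e x.2)
  have hj : Function.Injective j := by
    rintro ⟨n, p⟩ ⟨n', p'⟩ hh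
    simp only [j, Prod.mk.injEq] at hh
    have := he hh.2
    subst this
    simpa using hh.1
  let c : ℕ × ℤ × ℤ → ℂ := Function.extend j (fun x => d x.1 * w x.2) 0
  have hcj : ∀ x, c (j x) = d x.1 * w x.2 := fun x => hj.extend_apply _ _ x
  have hc0 : ∀ y, y ∉ Set.range j → c y = 0 := fun y hy => by
    simp only [c]; rw [Function.extend_apply' _ _ _ (by simpa using hy)]; rfl
  refine ⟨fun n a b => c (n, a, b), fun n a b hlt => ?_, fun τ z₁ z₂ hτ => ?_⟩
  · by_cases hy : (n, a, b) ∈ Set.range j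
    · obtain ⟨⟨m, p⟩, hx⟩ := hy
      simp only
      rw [← hx, hcj]
      by_cases hw : w p = 0
      · simp [hw]
      exfalso
      have h1 := hK p hw
      simp only [j, Prod.mk.injEq] at hx
      obtain ⟨h2, h3⟩ := hx
      rw [h3] at h1
      have hlt' : 4 * (n : ℝ) < (a : ℝ) ^ 2 + (b : ℝ) ^ 2 := by
        rw [Nat.cast_one, mul_one] at hlt
        exact_mod_cast hlt
      have h2' : (n : ℝ) = m + K p := by exact_mod_cast h2.symm
      have : (0 : ℝ) ≤ m := by positivity
      simp only at h1
      linarith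
    · exact hc0 _ hy
  · rw [← hj.hasSum_iff (fun y hy => by
      have := hc0 y hy
      simp only
      rw [show c (y.1, y.2.1, y.2.2) = 0 from this, zero_mul])]
    refine HasSum_of_eq (hs_prod (hH τ hτ) (hT τ z₁ z₂ hτ)) fun x => ?_
    simp only [Function.comp]
    rw [show c ((j x).1, (j x).2.1, (j x).2.2) = d x.1 * w x.2 from hcj x]
    by_cases hw : w x.2 = 0
    · simp [hw]
    have h1 : (K x.2 : ℂ) = ρ + (((e x.2).1 : ℂ) ^ 2 + ((e x.2).2 : ℂ) ^ 2) / 4 := by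
      have := congrArg (fun r : ℝ => (r : ℂ)) (hK x.2 hw)
      push_cast at this
      exact this
    rw [mul_mul_mul_comm, ← eC_add]
    congr 2
    simp only [j]
    push_cast
    rw [h1]; ring

lemma hs_th0 {τ : ℂ} (hτ : UHP τ) (z : ℂ) :
    HasSum (fun n : ℤ => eC ((n : ℂ) ^ 2 / 2 * τ + n * z)) (th0 τ z) := by
  refine HasSum_of_eq (hasSum_jacobiTheta₂_term z hτ) fun n => ?_
  rw [jacobiTheta₂_term, eC]; congr 1; ring

lemma hs_th1 {τ : ℂ} (hτ : UHP τ) (z : ℂ) :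
    HasSum (fun n : ℤ => (-1 : ℂ) ^ n * eC ((n : ℂ) ^ 2 / 2 * τ + n * z)) (th1 τ z) := by
  refine HasSum_of_eq (hs_th0 hτ (z + 1 / 2)) fun n => ?_
  rw [show (n : ℂ) ^ 2 / 2 * τ + n * (z + 1 / 2) = n * (1 / 2) + ((n : ℂ) ^ 2 / 2 * τ + n * z) by
    ring, eC_add _ ((n : ℂ) ^ 2 / 2 * τ + n * z)]
  congr 1
  rw [← eC_half, eC, eC, ← Complex.exp_int_mul]; congr 1; ring

lemma hs_th2 {τ : ℂ} (hτ : UHP τ) (z : ℂ) :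
    HasSum (fun n : ℤ => eC (((n : ℂ) + 1 / 2) ^ 2 / 2 * τ + (n + 1 / 2) * z)) (th2 τ z) := by
  refine HasSum_of_eq ((hs_th0 hτ (z + τ / 2)).mul_left (eC (τ / 8 + z / 2))) fun n => ?_
  rw [← eC_add]; congr 1; ring

section
variable {k : ℕ} {ψ : ℂ → ℂ → ℂ}

def e0 (p : ℤ × ℤ) : ℤ × ℤ := (p.1 + p.2, p.1 - p.2)
def e1 (p : ℤ × ℤ) : ℤ × ℤ := (p.1 + p.2 + 1, p.1 - p.2)

lemma e0_inj : Function.Injective e0 := by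
  rintro ⟨a, b⟩ ⟨c, d⟩ h
  simp only [e0, Prod.mk.injEq] at h ⊢
  omega
lemma e1_inj : Function.Injective e1 := by
  rintro ⟨a, b⟩ ⟨c, d⟩ h
  simp only [e1, Prod.mk.injEq] at h ⊢
  omega

lemma hs_00 {τ : ℂ} (hτ : UHP τ) (z₁ z₂ : ℂ) :
    HasSum (fun p : ℤ × ℤ => eC ((((e0 p).1 : ℂ) ^ 2 + ((e0 p).2 : ℂ) ^ 2) / 4 * τ
        + ((((e0 p).1 : ℂ) + ((e0 p).2 : ℂ) * I) / 2) * z₁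
        + ((((e0 p).1 : ℂ) - ((e0 p).2 : ℂ) * I) / 2) * z₂))
      (th0 τ (uu z₁ z₂) * th0 τ (vv z₁ z₂)) := by
  refine HasSum_of_eq (hs_prod (hs_th0 hτ _) (hs_th0 hτ _)) fun p => ?_
  rw [← eC_add]; congr 1; simp only [e0, uu, vv]; push_cast; ring

lemma hs_11 {τ : ℂ} (hτ : UHP τ) (z₁ z₂ : ℂ) :
    HasSum (fun p : ℤ × ℤ => (-1 : ℂ) ^ (p.1 + p.2) *
      eC ((((e0 p).1 : ℂ) ^ 2 + ((e0 p).2 : ℂ) ^ 2) / 4 * τ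
        + ((((e0 p).1 : ℂ) + ((e0 p).2 : ℂ) * I) / 2) * z₁
        + ((((e0 p).1 : ℂ) - ((e0 p).2 : ℂ) * I) / 2) * z₂))
      (th1 τ (uu z₁ z₂) * th1 τ (vv z₁ z₂)) := by
  refine HasSum_of_eq (hs_prod (hs_th1 hτ _) (hs_th1 hτ _)) fun p => ?_
  rw [mul_mul_mul_comm, ← eC_add, zpow_add₀ (by norm_num)]
  congr 2; simp only [e0, uu, vv]; push_cast; ring

lemma hs_22 {τ : ℂ} (hτ : UHP τ) (z₁ z₂ : ℂ) :
    HasSum (fun p : ℤ × ℤ => (1 : ℂ) * eC ((((e1 p).1 : ℂ) ^ 2 + ((e1 p).2 : ℂ) ^ 2) / 4 * τ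
        + ((((e1 p).1 : ℂ) + ((e1 p).2 : ℂ) * I) / 2) * z₁
        + ((((e1 p).1 : ℂ) - ((e1 p).2 : ℂ) * I) / 2) * z₂))
      (th2 τ (uu z₁ z₂) * th2 τ (vv z₁ z₂)) := by
  refine HasSum_of_eq (hs_prod (hs_th2 hτ _) (hs_th2 hτ _)) fun p => ?_
  rw [one_mul, ← eC_add]; congr 1; simp only [e1, uu, vv]; push_cast; ring

lemma nat_of {r : ℝ} (K : ℤ) (h0 : 0 ≤ K) (h : r = K) : ∃ K : ℕ, (K : ℝ) = r := by
  lift K to ℕ using h0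
  exact ⟨K, by rw [h]; simp⟩

lemma Phi_fourier (h : IsJF k 2 ψ) : FC (Phi ψ) := by
  obtain ⟨d, hd⟩ := exp00 h
  obtain ⟨d', hd'⟩ := exp11 h
  obtain ⟨d'', hd''⟩ := exp10 h
  have A := FC_mul d 0 le_rfl _ (by simpa using hd) (fun p => (1 + (-1 : ℂ) ^ (p.1 + p.2)) / 2) e0
    e0_inj (fun p hp => by
      have hev : Even (p.1 + p.2) := by
        by_contra ho
        rw [Int.not_even_iff_odd] at ho
        exact hp (by simp [ho.neg_one_zpow])
      obtain ⟨r, hr⟩ := hev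
      have h2 : p.1 = r + r - p.2 := by omega
      refine nat_of (r ^ 2 + (r - p.2) ^ 2) (by positivity) ?_
      simp only [e0, h2]; push_cast; ring)
    (fun τ z₁ z₂ => (th0 τ (uu z₁ z₂) * th0 τ (vv z₁ z₂) + th1 τ (uu z₁ z₂) * th1 τ (vv z₁ z₂)) / 2)
    (fun τ z₁ z₂ hτ => HasSum_of_eq (((hs_00 hτ z₁ z₂).add (hs_11 hτ z₁ z₂)).div_const 2)
      fun p => by ring)
  have B := FC_mul d' (1 / 2) (by norm_num) _ (by push_cast; exact hd')
    (fun p => (1 - (-1 : ℂ) ^ (p.1 + p.2)) / 2) e0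
    e0_inj (fun p hp => by
      have hev : Odd (p.1 + p.2) := by
        by_contra ho
        rw [Int.not_odd_iff_even] at ho
        exact hp (by simp [ho.neg_one_zpow])
      obtain ⟨r, hr⟩ := hev
      have h2 : p.1 = 2 * r + 1 - p.2 := by omega
      refine nat_of (r ^ 2 + r + (r - p.2) ^ 2 + (r - p.2) + 1)
        (by nlinarith [sq_nonneg (2 * r + 1), sq_nonneg (2 * (r - p.2) + 1)]) ?_
      simp only [e0, h2]; push_cast; ring)
    (fun τ z₁ z₂ => (th0 τ (uu z₁ z₂) * th0 τ (vv z₁ z₂) - th1 τ (uu z₁ z₂) * th1 τ (vv z₁ z₂)) / 2)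
    (fun τ z₁ z₂ hτ => HasSum_of_eq (((hs_00 hτ z₁ z₂).sub (hs_11 hτ z₁ z₂)).div_const 2)
      fun p => by ring)
  have C := FC_mul d'' (3 / 4) (by norm_num) _ (by push_cast; exact hd'')
    (fun _ => 1) e1 e1_inj (fun p _ => by
      obtain ⟨r, hr⟩ := Int.even_mul_succ_self p.1
      obtain ⟨s, hs⟩ := Int.even_mul_succ_self p.2
      refine nat_of (r + s + 1) (by nlinarith [sq_nonneg (2 * p.1 + 1), sq_nonneg (2 * p.2 + 1)]) ?_
      have hr' : (p.1 : ℝ) * (p.1 + 1) = r + r := by exact_mod_cast hr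
      have hs' : (p.2 : ℝ) * (p.2 + 1) = s + s := by exact_mod_cast hs
      simp only [e1]; push_cast
      linear_combination hr' / 2 + hs' / 2)
    (fun τ z₁ z₂ => th2 τ (uu z₁ z₂) * th2 τ (vv z₁ z₂))
    (fun τ z₁ z₂ hτ => hs_22 hτ z₁ z₂)
  have D := (A.add B).add C
  convert D using 4
  simp only [Phi]; ring
end

/-- for `k ≡ 0 (mod 4)`, the restriction map
`π_{1+i} : J_{k,1}(O_K) → J_{k,2}`, `(π_{1+i}φ)(τ,z) = φ(τ,(1+i)z,(1-i)z)`,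
is an isomorphism of ℂ-vector spaces. -/
theorem stmt7 (k : ℕ) (hk : 0 < k) (hk4 : k % 4 = 0) :
    (∀ φ : ℂ → ℂ → ℂ → ℂ, IsHJF k 1 φ →
      IsJF k 2 (fun τ z => φ τ ((1 + Complex.I) * z) ((1 - Complex.I) * z))) ∧
    (∀ φ φ' : ℂ → ℂ → ℂ → ℂ, IsHJF k 1 φ → IsHJF k 1 φ' →
      (∀ τ z : ℂ, UHP τ →
        φ τ ((1 + Complex.I) * z) ((1 - Complex.I) * z)
          = φ' τ ((1 + Complex.I) * z) ((1 - Complex.I) * z)) →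
      ∀ τ z₁ z₂ : ℂ, UHP τ → φ τ z₁ z₂ = φ' τ z₁ z₂) ∧
    (∀ ψ : ℂ → ℂ → ℂ, IsJF k 2 ψ →
      ∃ φ : ℂ → ℂ → ℂ → ℂ, IsHJF k 1 φ ∧
        ∀ τ z : ℂ, UHP τ → φ τ ((1 + Complex.I) * z) ((1 - Complex.I) * z) = ψ τ z) := by
  have hev : Even k := (Nat.dvd_of_mod_eq_zero (by omega : k % 2 = 0)).elim fun a ha => ⟨a, by omega⟩
  exact ⟨restr_JF k, fun φ φ' h h' e τ z₁ z₂ hτ => restr_inj k hk4 φ φ' h h' e τ z₁ z₂ hτ,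
    fun ψ h => ⟨Phi ψ, { holo := Phi_holo h
                         transf := Phi_transf hk4 h
                         ellip := fun p q u v τ z₁ z₂ _ => Phi_ell τ p q u v z₁ z₂
                         fourier := Phi_fourier h },
      fun τ z hτ => Phi_restr hev h hτ z⟩⟩
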